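/- arXiv:0805.3561 — 2 statements merged into one kernel-verified Lean document; each statement's English description precedes it below -/
import Mathlib

section
/- Let φ : ℚ[y1,y4] → ℚ[y1,y4] be the ℚ-algebra endomorphism determined by φ(y1) = k*y1 and φ(y4) = a*y1^4 + b*y4, where k, a, b ∈ ℚ. If φ(g8) ∈ I and φ(g12) ∈ I (i.e. φ maps the ideal I into itself), then a = 0 and b = k^4. (This is the rigidity computation for X = F4/B3·S1: every degree-preserving endomorphism of H*(X;ℚ) sending the Kaehlerian class y1 to k*y1 is the Adams operator ψ^k.) -/
open MvPolynomial

/-- The exponent vector of `y1 ^ i * y4 ^ j`. -/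
noncomputable def expo (i j : ℕ) : Fin 2 →₀ ℕ := Finsupp.single 0 i + Finsupp.single 1 j

lemma expo_zero (i j : ℕ) : expo i j 0 = i := by simp [expo]

lemma expo_one (i j : ℕ) : expo i j 1 = j := by simp [expo]

lemma expo_le (i j p q : ℕ) : expo p q ≤ expo i j ↔ p ≤ i ∧ q ≤ j := by
  rw [Finsupp.le_def, Fin.forall_fin_two]
  simp only [expo_zero, expo_one]

lemma expo_sub (i j p q : ℕ) : expo i j - expo p q = expo (i - p) (j - q) := by
  ext t
  fin_cases t <;> simp [expo]

lemma expo_inj (i j p q : ℕ) : expo p q = expo i j ↔ p = i ∧ q = j := by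
  constructor
  · intro h
    have h0 := DFunLike.congr_fun h 0
    have h1 := DFunLike.congr_fun h 1
    rw [expo_zero, expo_zero] at h0
    rw [expo_one, expo_one] at h1
    exact ⟨h0, h1⟩
  · rintro ⟨rfl, rfl⟩; rfl

lemma mono_eq (i j : ℕ) (r : ℚ) :
    (monomial (expo i j) r : MvPolynomial (Fin 2) ℚ) = C r * X 0 ^ i * X 1 ^ j := by
  rw [expo, X_pow_eq_monomial, X_pow_eq_monomial, C_mul_monomial, monomial_mul]
  simp

lemma coeff_mul_expo (A : MvPolynomial (Fin 2) ℚ) (i j p q : ℕ) (r : ℚ) :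
    coeff (expo i j) (A * monomial (expo p q) r)
      = if p ≤ i ∧ q ≤ j then coeff (expo (i - p) (j - q)) A * r else 0 := by
  rw [coeff_mul_monomial']
  simp only [expo_le, expo_sub]

lemma coeff_expo (i j p q : ℕ) (r : ℚ) :
    coeff (expo i j) (monomial (expo p q) r : MvPolynomial (Fin 2) ℚ)
      = if p = i ∧ q = j then r else 0 := by
  rw [coeff_monomial]
  simp only [expo_inj]

lemma g8_eq : (3 * X 1 ^ 2 - X 0 ^ 8 : MvPolynomial (Fin 2) ℚ)
    = monomial (expo 0 2) 3 + monomial (expo 8 0) (-1) := by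
  rw [mono_eq, mono_eq, C_neg, C_1, show (C 3 : MvPolynomial (Fin 2) ℚ) = 3 from map_ofNat C 3]
  ring

lemma g12_eq : (26 * X 1 ^ 3 - 5 * X 0 ^ 12 : MvPolynomial (Fin 2) ℚ)
    = monomial (expo 0 3) 26 + monomial (expo 12 0) (-5) := by
  rw [mono_eq, mono_eq, C_neg, show (C 26 : MvPolynomial (Fin 2) ℚ) = 26 from map_ofNat C 26,
    show (C 5 : MvPolynomial (Fin 2) ℚ) = 5 from map_ofNat C 5]
  ring

/-- Linear relations satisfied by the coefficients of an element of the ideal. -/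
lemma coeff_rel (f : MvPolynomial (Fin 2) ℚ)
    (h : f ∈ Ideal.span {(3 * X 1 ^ 2 - X 0 ^ 8 : MvPolynomial (Fin 2) ℚ),
      26 * X 1 ^ 3 - 5 * X 0 ^ 12}) :
    coeff (expo 4 1) f = 0 ∧ coeff (expo 0 2) f + 3 * coeff (expo 8 0) f = 0 ∧
    15 * coeff (expo 0 3) f + 26 * (3 * coeff (expo 12 0) f + coeff (expo 4 2) f)
      + 45 * coeff (expo 8 1) f = 0 := by
  obtain ⟨A, B, rfl⟩ := Ideal.mem_span_pair.1 h
  rw [g8_eq, g12_eq]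
  simp only [mul_add, coeff_add, coeff_mul_expo]
  norm_num
  constructor <;> ring

lemma image8_eq (k a b : ℚ) :
    (3 * (C a * X 0 ^ 4 + C b * X 1) ^ 2 - (C k * X 0) ^ 8 : MvPolynomial (Fin 2) ℚ)
    = monomial (expo 0 2) (3 * b ^ 2) + monomial (expo 4 1) (6 * a * b)
      + monomial (expo 8 0) (3 * a ^ 2 - k ^ 8) := by
  simp only [mono_eq, C_mul, C_sub, C_pow,
    show (C 3 : MvPolynomial (Fin 2) ℚ) = 3 from map_ofNat C 3,
    show (C 6 : MvPolynomial (Fin 2) ℚ) = 6 from map_ofNat C 6]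
  ring

lemma image12_eq (k b : ℚ) :
    (26 * (C 0 * X 0 ^ 4 + C b * X 1) ^ 3 - 5 * (C k * X 0) ^ 12 : MvPolynomial (Fin 2) ℚ)
    = monomial (expo 0 3) (26 * b ^ 3) + monomial (expo 12 0) (-(5 * k ^ 12)) := by
  simp only [mono_eq, C_mul, C_neg, C_pow, C_0,
    show (C 26 : MvPolynomial (Fin 2) ℚ) = 26 from map_ofNat C 26,
    show (C 5 : MvPolynomial (Fin 2) ℚ) = 5 from map_ofNat C 5]
  ring

/-- `3` is not a square in `ℚ`. -/
lemma three_sq (a c : ℚ) (h : 3 * a ^ 2 = c ^ 2) : a = 0 := by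
  by_contra ha
  have h3 : Irrational (Real.sqrt (3 : ℕ)) := Nat.Prime.irrational_sqrt Nat.prime_three
  apply h3
  refine ⟨|c / a|, ?_⟩
  have : (3 : ℚ) = (c / a) ^ 2 := by field_simp; exact h
  have h' : ((3 : ℕ) : ℝ) = ((c / a : ℚ) : ℝ) ^ 2 := by
    rw [← Rat.cast_pow, ← this]; norm_num
  rw [h', Real.sqrt_sq_eq_abs, Rat.cast_abs]

/-- Rigidity computation for `X = F₄/B₃·S¹`. -/
theorem F4_B3_rigidity (k a b : ℚ)
    (y1 y4 g8 g12 : MvPolynomial (Fin 2) ℚ)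
    (hy1 : y1 = X 0) (hy4 : y4 = X 1)
    (hg8 : g8 = 3 * y4 ^ 2 - y1 ^ 8)
    (hg12 : g12 = 26 * y4 ^ 3 - 5 * y1 ^ 12)
    (I : Ideal (MvPolynomial (Fin 2) ℚ)) (hI : I = Ideal.span {g8, g12})
    (φ : MvPolynomial (Fin 2) ℚ →ₐ[ℚ] MvPolynomial (Fin 2) ℚ)
    (hφ1 : φ y1 = C k * y1)
    (hφ4 : φ y4 = C a * y1 ^ 4 + C b * y4)
    (h8 : φ g8 ∈ I) (h12 : φ g12 ∈ I) :
    a = 0 ∧ b = k ^ 4 := by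
  subst hy1 hy4 hg8 hg12 hI
  have e8 : φ (3 * X 1 ^ 2 - X 0 ^ 8)
      = 3 * (C a * X 0 ^ 4 + C b * X 1) ^ 2 - (C k * X 0) ^ 8 := by
    rw [map_sub, map_mul, map_pow, map_pow, hφ1, hφ4, map_ofNat]
  have e12 : φ (26 * X 1 ^ 3 - 5 * X 0 ^ 12)
      = 26 * (C a * X 0 ^ 4 + C b * X 1) ^ 3 - 5 * (C k * X 0) ^ 12 := by
    rw [map_sub, map_mul, map_mul, map_pow, map_pow, hφ1, hφ4, map_ofNat, map_ofNat]
  rw [e8, image8_eq] at h8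
  rw [e12] at h12
  obtain ⟨r1, r2, -⟩ := coeff_rel _ h8
  simp only [coeff_add, coeff_expo] at r1 r2
  norm_num at r1 r2
  have key : a = 0 := by
    rcases r1 with r1 | r1
    · exact r1
    · refine three_sq a (k ^ 4) ?_
      rw [r1] at r2
      linarith
  subst key
  refine ⟨rfl, ?_⟩
  rw [image12_eq] at h12
  obtain ⟨-, -, r3⟩ := coeff_rel _ h12
  simp only [coeff_add, coeff_expo] at r3
  norm_num at r3
  have hb : b ^ 3 = (k ^ 4) ^ 3 := by linarith
  exact (Odd.strictMono_pow (by decide : Odd 3)).injective hb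
end

section
/- Let φ : ℚ[y1,y3,y4,y5,y7] → ℚ[y1,y3,y4,y5,y7] be the ℚ-algebra endomorphism determined by φ(y1) = k*y1, φ(y3) = a1*y1^3 + a2*y3, φ(y4) = b1*y1^4 + b2*y1*y3 + b3*y4, φ(y5) = c1*y1^5 + c2*y1^2*y3 + c3*y1*y4 + c4*y5, and φ(y7) = d1*y1^7 + d2*y1^4*y3 + d3*y1^3*y4 + d4*y1*y3^2 + d5*y1^2*y5 + d6*y3*y4 + d7*y7, where all coefficients lie in ℚ. If φ(g8), φ(g10), φ(g12), φ(g14) and φ(g18) all lie in I, then a1 = b1 = b2 = c1 = c2 = c3 = d1 = d2 = d3 = d4 = d5 = d6 = 0 and a2 = k^3, b3 = k^4, c4 = k^5, d7 = k^7. (This is the rigidity computation for X = E7/A7·S1: every degree-preserving endomorphism of H*(X;ℚ) sending the Kaehlerian class y1 to k*y1 is the Adams operator ψ^k.) -/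
open MvPolynomial

namespace E7Aux

/-- Exponent vector. -/
noncomputable def mon (a b c d e : ℕ) : Fin 5 →₀ ℕ := Finsupp.equivFunOnFinite.symm ![a, b, c, d, e]

/-- Term with given coefficient and exponents. -/
noncomputable def T (r : ℚ) (a b c d e : ℕ) : MvPolynomial (Fin 5) ℚ := monomial (mon a b c d e) r

/-- Coefficient at given exponents. -/
noncomputable def cf (a b c d e : ℕ) (p : MvPolynomial (Fin 5) ℚ) : ℚ := coeff (mon a b c d e) p

theorem mon_le (a b c d e a' b' c' d' e' : ℕ) : mon a b c d e ≤ mon a' b' c' d' e' ↔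
    a ≤ a' ∧ b ≤ b' ∧ c ≤ c' ∧ d ≤ d' ∧ e ≤ e' := by
  rw [Finsupp.le_def]
  simp [Fin.forall_fin_succ, mon]

theorem mon_sub (a b c d e a' b' c' d' e' : ℕ) : mon a b c d e - mon a' b' c' d' e' =
    mon (a - a') (b - b') (c - c') (d - d') (e - e') := by
  ext i
  fin_cases i <;> simp [mon]

theorem mon_eq (a b c d e a' b' c' d' e' : ℕ) : mon a b c d e = mon a' b' c' d' e' ↔
    a = a' ∧ b = b' ∧ c = c' ∧ d = d' ∧ e = e' := by
  rw [Finsupp.ext_iff]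
  simp [Fin.forall_fin_succ, mon]

theorem T_eq (r : ℚ) (a b c d e : ℕ) :
    T r a b c d e = C r * X 0 ^ a * X 1 ^ b * X 2 ^ c * X 3 ^ d * X 4 ^ e := by
  unfold T
  rw [monomial_eq, Finsupp.prod_fintype _ _ (by simp)]
  simp [Fin.prod_univ_succ, mon]
  ring

theorem cf_add (a b c d e : ℕ) (p q : MvPolynomial (Fin 5) ℚ) :
    cf a b c d e (p + q) = cf a b c d e p + cf a b c d e q := coeff_add _ _ _

theorem cf_zero (a b c d e : ℕ) : cf a b c d e 0 = 0 := coeff_zero _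

theorem cf_T (a b c d e a' b' c' d' e' : ℕ) (r : ℚ) : cf a b c d e (T r a' b' c' d' e') =
    if a' = a ∧ b' = b ∧ c' = c ∧ d' = d ∧ e' = e then r else 0 := by
  simp only [cf, T, coeff_monomial, mon_eq]

theorem cf_mul_T (a b c d e a' b' c' d' e' : ℕ) (r : ℚ) (p : MvPolynomial (Fin 5) ℚ) :
    cf a b c d e (p * T r a' b' c' d' e') =
    if a' ≤ a ∧ b' ≤ b ∧ c' ≤ c ∧ d' ≤ d ∧ e' ≤ e then
      cf (a - a') (b - b') (c - c') (d - d') (e - e') p * r else 0 := by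
  simp only [cf, T, coeff_mul_monomial', mon_le, mon_sub]

/-- Relation in degree 8. -/
noncomputable def G8 : MvPolynomial (Fin 5) ℚ :=
    T (4) 1 0 0 0 1
    + T (-4) 0 1 0 1 0
    + T (2) 3 0 0 1 0
    + T (6) 0 0 2 0 0
    + T (-12) 1 1 1 0 0
    + T (3) 4 0 1 0 0
    + T (9) 2 2 0 0 0
    + T (-6) 5 1 0 0 0
    + T (1) 8 0 0 0 0

/-- Relation in degree 10. -/
noncomputable def G10 : MvPolynomial (Fin 5) ℚ :=
    T (-2) 0 1 0 0 1
    + T (1) 3 0 0 0 1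
    + T (1) 0 0 0 2 0

/-- Relation in degree 12. -/
noncomputable def G12 : MvPolynomial (Fin 5) ℚ :=
    T (8) 0 0 0 1 1
    + T (-24) 1 0 1 0 1
    + T (12) 2 1 0 0 1
    + T (-4) 0 0 3 0 0
    + T (4) 1 1 2 0 0
    + T (9) 4 0 2 0 0
    + T (-18) 2 2 1 0 0
    + T (-12) 5 1 1 0 0
    + T (6) 8 0 1 0 0
    + T (-3) 0 4 0 0 0
    + T (16) 3 3 0 0 0
    + T (-2) 6 2 0 0 0
    + T (-4) 9 1 0 0 0
    + T (1) 12 0 0 0 0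

/-- Relation in degree 14. -/
noncomputable def G14 : MvPolynomial (Fin 5) ℚ :=
    T (1) 0 0 0 0 2
    + T (-3) 2 0 0 1 1
    + T (3) 0 0 1 2 0
    + T (-1) 1 0 2 1 0
    + T (3) 2 1 1 1 0
    + T (1) 0 3 0 1 0
    + T (-3) 3 2 0 1 0
    + T (1) 6 1 0 1 0

/-- Relation in degree 18. -/
noncomputable def G18 : MvPolynomial (Fin 5) ℚ :=
    T (-4) 0 0 1 0 2
    + T (9) 4 0 0 0 2
    + T (-12) 1 0 0 2 1
    + T (-12) 2 0 1 1 1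
    + T (-4) 0 2 0 1 1
    + T (-8) 3 1 0 1 1
    + T (4) 6 0 0 1 1
    + T (6) 3 0 2 0 1
    + T (-18) 4 1 1 0 1
    + T (-6) 2 3 0 0 1
    + T (18) 5 2 0 0 1
    + T (-6) 8 1 0 0 1
    + T (8) 0 1 0 3 0
    + T (12) 0 0 2 2 0
    + T (-8) 1 0 3 1 0
    + T (24) 2 1 2 1 0
    + T (8) 0 3 1 1 0
    + T (-24) 3 2 1 1 0
    + T (8) 6 1 1 1 0
    + T (1) 2 0 4 0 0
    + T (-6) 3 1 3 0 0
    + T (-2) 1 3 2 0 0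
    + T (15) 4 2 2 0 0
    + T (-2) 7 1 2 0 0
    + T (6) 2 4 1 0 0
    + T (-18) 5 3 1 0 0
    + T (6) 8 2 1 0 0
    + T (1) 0 6 0 0 0
    + T (-6) 3 5 0 0 0
    + T (11) 6 4 0 0 0
    + T (-6) 9 3 0 0 0
    + T (1) 12 2 0 0 0

theorem mem_G (f : MvPolynomial (Fin 5) ℚ)
    (hf : f ∈ Ideal.span ({G8, G10, G12, G14, G18} : Set (MvPolynomial (Fin 5) ℚ))) :
    ∃ p q r s t, f = p * G8 + q * G10 + r * G12 + s * G14 + t * G18 := by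
  rw [Ideal.mem_span_insert] at hf
  obtain ⟨p, z, hz, rfl⟩ := hf
  rw [Ideal.mem_span_insert] at hz
  obtain ⟨q, z, hz, rfl⟩ := hz
  rw [Ideal.mem_span_insert] at hz
  obtain ⟨r, z, hz, rfl⟩ := hz
  rw [Ideal.mem_span_insert] at hz
  obtain ⟨s, z, hz, rfl⟩ := hz
  rw [Ideal.mem_span_singleton'] at hz
  obtain ⟨t, rfl⟩ := hz
  exact ⟨p, q, r, s, t, by ring⟩

theorem deg8_coeff (k a1 a2 b1 b2 b3 c1 c2 c3 c4 d1 d2 d3 d4 d5 d6 d7 : ℚ)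
    (hf : T (4*d7*k) 1 0 0 0 1
    + T (-4*a2*c4) 0 1 0 1 0
    + T (-4*a1*c4 + 2*c4*k^3 + 4*d5*k) 3 0 0 1 0
    + T (6*b3^2) 0 0 2 0 0
    + T (-12*a2*b3*k - 4*a2*c3 + 12*b2*b3 + 4*d6*k) 1 1 1 0 0
    + T (-12*a1*b3*k - 4*a1*c3 + 12*b1*b3 + 3*b3*k^4 + 2*c3*k^3 + 4*d3*k) 4 0 1 0 0
    + T (-12*a2*b2*k - 4*a2*c2 + 9*a2^2*k^2 + 6*b2^2 + 4*d4*k) 2 2 0 0 0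
    + T (18*a1*a2*k^2 - 12*a1*b2*k - 4*a1*c2 - 12*a2*b1*k - 4*a2*c1 - 6*a2*k^5 + 12*b1*b2 + 3*b2*k^4 + 2*c2*k^3 + 4*d2*k) 5 1 0 0 0
    + T (-12*a1*b1*k - 4*a1*c1 - 6*a1*k^5 + 9*a1^2*k^2 + 3*b1*k^4 + 6*b1^2 + 2*c1*k^3 + 4*d1*k + k^8) 8 0 0 0 0
    ∈ Ideal.span ({G8, G10, G12, G14, G18} : Set (MvPolynomial (Fin 5) ℚ))) :
    ∃ m8_8_ : ℚ,
    4*d7*k - 4*m8_8_ = 0 ∧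
    -4*a2*c4 + 4*m8_8_ = 0 ∧
    -4*a1*c4 + 2*c4*k^3 + 4*d5*k - 2*m8_8_ = 0 ∧
    6*b3^2 - 6*m8_8_ = 0 ∧
    -12*a2*b3*k - 4*a2*c3 + 12*b2*b3 + 4*d6*k + 12*m8_8_ = 0 ∧
    -12*a1*b3*k - 4*a1*c3 + 12*b1*b3 + 3*b3*k^4 + 2*c3*k^3 + 4*d3*k - 3*m8_8_ = 0 ∧
    -12*a2*b2*k - 4*a2*c2 + 9*a2^2*k^2 + 6*b2^2 + 4*d4*k - 9*m8_8_ = 0 ∧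
    18*a1*a2*k^2 - 12*a1*b2*k - 4*a1*c2 - 12*a2*b1*k - 4*a2*c1 - 6*a2*k^5 + 12*b1*b2 + 3*b2*k^4 + 2*c2*k^3 + 4*d2*k + 6*m8_8_ = 0 ∧
    -12*a1*b1*k - 4*a1*c1 - 6*a1*k^5 + 9*a1^2*k^2 + 3*b1*k^4 + 6*b1^2 + 2*c1*k^3 + 4*d1*k + k^8 - m8_8_ = 0 := by
  obtain ⟨p, q, r, s, t, h⟩ := mem_G _ hf
  simp only [G8, G10, G12, G14, G18, mul_add] at h
  refine ⟨cf 0 0 0 0 0 p, ?_, ?_, ?_, ?_, ?_, ?_, ?_, ?_, ?_⟩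
  · have e := congrArg (cf 1 0 0 0 1) h
    simp [cf_add, cf_T, cf_mul_T, -mul_eq_zero, -zero_eq_mul, -pow_eq_zero_iff, -mul_eq_mul_left_iff, -mul_eq_mul_right_iff, -neg_eq_zero, -zero_eq_neg] at e
    linarith
  · have e := congrArg (cf 0 1 0 1 0) h
    simp [cf_add, cf_T, cf_mul_T, -mul_eq_zero, -zero_eq_mul, -pow_eq_zero_iff, -mul_eq_mul_left_iff, -mul_eq_mul_right_iff, -neg_eq_zero, -zero_eq_neg] at e
    linarith
  · have e := congrArg (cf 3 0 0 1 0) h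
    simp [cf_add, cf_T, cf_mul_T, -mul_eq_zero, -zero_eq_mul, -pow_eq_zero_iff, -mul_eq_mul_left_iff, -mul_eq_mul_right_iff, -neg_eq_zero, -zero_eq_neg] at e
    linarith
  · have e := congrArg (cf 0 0 2 0 0) h
    simp [cf_add, cf_T, cf_mul_T, -mul_eq_zero, -zero_eq_mul, -pow_eq_zero_iff, -mul_eq_mul_left_iff, -mul_eq_mul_right_iff, -neg_eq_zero, -zero_eq_neg] at e
    linarith
  · have e := congrArg (cf 1 1 1 0 0) h
    simp [cf_add, cf_T, cf_mul_T, -mul_eq_zero, -zero_eq_mul, -pow_eq_zero_iff, -mul_eq_mul_left_iff, -mul_eq_mul_right_iff, -neg_eq_zero, -zero_eq_neg] at e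
    linarith
  · have e := congrArg (cf 4 0 1 0 0) h
    simp [cf_add, cf_T, cf_mul_T, -mul_eq_zero, -zero_eq_mul, -pow_eq_zero_iff, -mul_eq_mul_left_iff, -mul_eq_mul_right_iff, -neg_eq_zero, -zero_eq_neg] at e
    linarith
  · have e := congrArg (cf 2 2 0 0 0) h
    simp [cf_add, cf_T, cf_mul_T, -mul_eq_zero, -zero_eq_mul, -pow_eq_zero_iff, -mul_eq_mul_left_iff, -mul_eq_mul_right_iff, -neg_eq_zero, -zero_eq_neg] at e
    linarith
  · have e := congrArg (cf 5 1 0 0 0) h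
    simp [cf_add, cf_T, cf_mul_T, -mul_eq_zero, -zero_eq_mul, -pow_eq_zero_iff, -mul_eq_mul_left_iff, -mul_eq_mul_right_iff, -neg_eq_zero, -zero_eq_neg] at e
    linarith
  · have e := congrArg (cf 8 0 0 0 0) h
    simp [cf_add, cf_T, cf_mul_T, -mul_eq_zero, -zero_eq_mul, -pow_eq_zero_iff, -mul_eq_mul_left_iff, -mul_eq_mul_right_iff, -neg_eq_zero, -zero_eq_neg] at e
    linarith

theorem deg10_coeff (k a1 a2 c1 c2 c3 c4 d1 d2 d3 d4 d5 d6 d7 : ℚ)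
    (hf : T (-2*a2*d7) 0 1 0 0 1
    + T (-2*a1*d7 + d7*k^3) 3 0 0 0 1
    + T (c4^2) 0 0 0 2 0
    + T (2*c3*c4) 1 0 1 1 0
    + T (-2*a2*d5 + 2*c2*c4) 2 1 0 1 0
    + T (-2*a1*d5 + 2*c1*c4 + d5*k^3) 5 0 0 1 0
    + T (c3^2) 2 0 2 0 0
    + T (-2*a2*d6) 0 2 1 0 0
    + T (-2*a1*d6 - 2*a2*d3 + 2*c2*c3 + d6*k^3) 3 1 1 0 0
    + T (-2*a1*d3 + 2*c1*c3 + d3*k^3) 6 0 1 0 0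
    + T (-2*a2*d4) 1 3 0 0 0
    + T (-2*a1*d4 - 2*a2*d2 + c2^2 + d4*k^3) 4 2 0 0 0
    + T (-2*a1*d2 - 2*a2*d1 + 2*c1*c2 + d2*k^3) 7 1 0 0 0
    + T (-2*a1*d1 + c1^2 + d1*k^3) 10 0 0 0 0
    ∈ Ideal.span ({G8, G10, G12, G14, G18} : Set (MvPolynomial (Fin 5) ℚ))) :
    ∃ m10_10_ m10_8_11 : ℚ,
    -2*a2*d7 + 2*m10_10_ = 0 ∧
    -2*a1*d7 + d7*k^3 - m10_10_ - 4*m10_8_11 = 0 ∧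
    c4^2 - m10_10_ = 0 ∧
    2*c3*c4 = 0 ∧
    -2*a2*d5 + 2*c2*c4 + 4*m10_8_11 = 0 ∧
    -2*a1*d5 + 2*c1*c4 + d5*k^3 - 2*m10_8_11 = 0 ∧
    c3^2 - 6*m10_8_11 = 0 ∧
    -2*a2*d6 = 0 ∧
    -2*a1*d6 - 2*a2*d3 + 2*c2*c3 + d6*k^3 + 12*m10_8_11 = 0 ∧
    -2*a1*d3 + 2*c1*c3 + d3*k^3 - 3*m10_8_11 = 0 ∧
    -2*a2*d4 = 0 ∧
    -2*a1*d4 - 2*a2*d2 + c2^2 + d4*k^3 - 9*m10_8_11 = 0 ∧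
    -2*a1*d2 - 2*a2*d1 + 2*c1*c2 + d2*k^3 + 6*m10_8_11 = 0 ∧
    -2*a1*d1 + c1^2 + d1*k^3 - m10_8_11 = 0 := by
  obtain ⟨p, q, r, s, t, h⟩ := mem_G _ hf
  simp only [G8, G10, G12, G14, G18, mul_add] at h
  refine ⟨cf 0 0 0 0 0 q, cf 2 0 0 0 0 p, ?_, ?_, ?_, ?_, ?_, ?_, ?_, ?_, ?_, ?_, ?_, ?_, ?_, ?_⟩
  · have e := congrArg (cf 0 1 0 0 1) h
    simp [cf_add, cf_T, cf_mul_T, -mul_eq_zero, -zero_eq_mul, -pow_eq_zero_iff, -mul_eq_mul_left_iff, -mul_eq_mul_right_iff, -neg_eq_zero, -zero_eq_neg] at e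
    linarith
  · have e := congrArg (cf 3 0 0 0 1) h
    simp [cf_add, cf_T, cf_mul_T, -mul_eq_zero, -zero_eq_mul, -pow_eq_zero_iff, -mul_eq_mul_left_iff, -mul_eq_mul_right_iff, -neg_eq_zero, -zero_eq_neg] at e
    linarith
  · have e := congrArg (cf 0 0 0 2 0) h
    simp [cf_add, cf_T, cf_mul_T, -mul_eq_zero, -zero_eq_mul, -pow_eq_zero_iff, -mul_eq_mul_left_iff, -mul_eq_mul_right_iff, -neg_eq_zero, -zero_eq_neg] at e
    linarith
  · have e := congrArg (cf 1 0 1 1 0) h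
    simp [cf_add, cf_T, cf_mul_T, -mul_eq_zero, -zero_eq_mul, -pow_eq_zero_iff, -mul_eq_mul_left_iff, -mul_eq_mul_right_iff, -neg_eq_zero, -zero_eq_neg] at e
    linarith
  · have e := congrArg (cf 2 1 0 1 0) h
    simp [cf_add, cf_T, cf_mul_T, -mul_eq_zero, -zero_eq_mul, -pow_eq_zero_iff, -mul_eq_mul_left_iff, -mul_eq_mul_right_iff, -neg_eq_zero, -zero_eq_neg] at e
    linarith
  · have e := congrArg (cf 5 0 0 1 0) h
    simp [cf_add, cf_T, cf_mul_T, -mul_eq_zero, -zero_eq_mul, -pow_eq_zero_iff, -mul_eq_mul_left_iff, -mul_eq_mul_right_iff, -neg_eq_zero, -zero_eq_neg] at e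
    linarith
  · have e := congrArg (cf 2 0 2 0 0) h
    simp [cf_add, cf_T, cf_mul_T, -mul_eq_zero, -zero_eq_mul, -pow_eq_zero_iff, -mul_eq_mul_left_iff, -mul_eq_mul_right_iff, -neg_eq_zero, -zero_eq_neg] at e
    linarith
  · have e := congrArg (cf 0 2 1 0 0) h
    simp [cf_add, cf_T, cf_mul_T, -mul_eq_zero, -zero_eq_mul, -pow_eq_zero_iff, -mul_eq_mul_left_iff, -mul_eq_mul_right_iff, -neg_eq_zero, -zero_eq_neg] at e
    linarith
  · have e := congrArg (cf 3 1 1 0 0) h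
    simp [cf_add, cf_T, cf_mul_T, -mul_eq_zero, -zero_eq_mul, -pow_eq_zero_iff, -mul_eq_mul_left_iff, -mul_eq_mul_right_iff, -neg_eq_zero, -zero_eq_neg] at e
    linarith
  · have e := congrArg (cf 6 0 1 0 0) h
    simp [cf_add, cf_T, cf_mul_T, -mul_eq_zero, -zero_eq_mul, -pow_eq_zero_iff, -mul_eq_mul_left_iff, -mul_eq_mul_right_iff, -neg_eq_zero, -zero_eq_neg] at e
    linarith
  · have e := congrArg (cf 1 3 0 0 0) h
    simp [cf_add, cf_T, cf_mul_T, -mul_eq_zero, -zero_eq_mul, -pow_eq_zero_iff, -mul_eq_mul_left_iff, -mul_eq_mul_right_iff, -neg_eq_zero, -zero_eq_neg] at e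
    linarith
  · have e := congrArg (cf 4 2 0 0 0) h
    simp [cf_add, cf_T, cf_mul_T, -mul_eq_zero, -zero_eq_mul, -pow_eq_zero_iff, -mul_eq_mul_left_iff, -mul_eq_mul_right_iff, -neg_eq_zero, -zero_eq_neg] at e
    linarith
  · have e := congrArg (cf 7 1 0 0 0) h
    simp [cf_add, cf_T, cf_mul_T, -mul_eq_zero, -zero_eq_mul, -pow_eq_zero_iff, -mul_eq_mul_left_iff, -mul_eq_mul_right_iff, -neg_eq_zero, -zero_eq_neg] at e
    linarith
  · have e := congrArg (cf 10 0 0 0 0) h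
    simp [cf_add, cf_T, cf_mul_T, -mul_eq_zero, -zero_eq_mul, -pow_eq_zero_iff, -mul_eq_mul_left_iff, -mul_eq_mul_right_iff, -neg_eq_zero, -zero_eq_neg] at e
    linarith

theorem deg12_coeff (k a1 a2 b1 b2 b3 c1 c2 c3 c4 d1 d2 d3 d4 d5 d6 d7 : ℚ)
    (hf : T (8*c4*d7) 0 0 0 1 1
    + T (-24*b3*d7*k + 8*c3*d7) 1 0 1 0 1
    + T (12*a2*d7*k^2 - 24*b2*d7*k + 8*c2*d7) 2 1 0 0 1
    + T (12*a1*d7*k^2 - 24*b1*d7*k + 8*c1*d7) 5 0 0 0 1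
    + T (8*c4*d5) 2 0 0 2 0
    + T (8*c4*d6) 0 1 1 1 0
    + T (-24*b3*d5*k + 8*c3*d5 + 8*c4*d3) 3 0 1 1 0
    + T (8*c4*d4) 1 2 0 1 0
    + T (12*a2*d5*k^2 - 24*b2*d5*k + 8*c2*d5 + 8*c4*d2) 4 1 0 1 0
    + T (12*a1*d5*k^2 - 24*b1*d5*k + 8*c1*d5 + 8*c4*d1) 7 0 0 1 0
    + T (-4*b3^3) 0 0 3 0 0
    + T (4*a2*b3^2*k - 12*b2*b3^2 - 24*b3*d6*k + 8*c3*d6) 1 1 2 0 0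
    + T (4*a1*b3^2*k - 12*b1*b3^2 - 24*b3*d3*k + 9*b3^2*k^4 + 8*c3*d3) 4 0 2 0 0
    + T (8*a2*b2*b3*k + 12*a2*d6*k^2 - 18*a2^2*b3*k^2 - 24*b2*d6*k - 12*b2^2*b3 - 24*b3*d4*k + 8*c2*d6 + 8*c3*d4) 2 2 1 0 0
    + T (-36*a1*a2*b3*k^2 + 8*a1*b2*b3*k + 12*a1*d6*k^2 + 8*a2*b1*b3*k - 12*a2*b3*k^5 + 12*a2*d3*k^2 - 24*b1*b2*b3 - 24*b1*d6*k + 18*b2*b3*k^4 - 24*b2*d3*k - 24*b3*d2*k + 8*c1*d6 + 8*c2*d3 + 8*c3*d2) 5 1 1 0 0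
    + T (8*a1*b1*b3*k - 12*a1*b3*k^5 + 12*a1*d3*k^2 - 18*a1^2*b3*k^2 + 18*b1*b3*k^4 - 24*b1*d3*k - 12*b1^2*b3 - 24*b3*d1*k + 6*b3*k^8 + 8*c1*d3 + 8*c3*d1) 8 0 1 0 0
    + T (-3*a2^4) 0 4 0 0 0
    + T (-12*a1*a2^3 + 4*a2*b2^2*k + 12*a2*d4*k^2 - 18*a2^2*b2*k^2 + 16*a2^3*k^3 - 24*b2*d4*k - 4*b2^3 + 8*c2*d4) 3 3 0 0 0
    + T (-36*a1*a2*b2*k^2 + 48*a1*a2^2*k^3 + 4*a1*b2^2*k + 12*a1*d4*k^2 - 18*a1^2*a2^2 + 8*a2*b1*b2*k - 12*a2*b2*k^5 + 12*a2*d2*k^2 - 18*a2^2*b1*k^2 - 2*a2^2*k^6 - 12*b1*b2^2 - 24*b1*d4*k - 24*b2*d2*k + 9*b2^2*k^4 + 8*c1*d4 + 8*c2*d2) 6 2 0 0 0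
    + T (-36*a1*a2*b1*k^2 - 4*a1*a2*k^6 + 8*a1*b1*b2*k - 12*a1*b2*k^5 + 12*a1*d2*k^2 + 48*a1^2*a2*k^3 - 18*a1^2*b2*k^2 - 12*a1^3*a2 - 12*a2*b1*k^5 + 4*a2*b1^2*k + 12*a2*d1*k^2 - 4*a2*k^9 + 18*b1*b2*k^4 - 24*b1*d2*k - 12*b1^2*b2 - 24*b2*d1*k + 6*b2*k^8 + 8*c1*d2 + 8*c2*d1) 9 1 0 0 0
    + T (-12*a1*b1*k^5 + 4*a1*b1^2*k + 12*a1*d1*k^2 - 4*a1*k^9 - 18*a1^2*b1*k^2 - 2*a1^2*k^6 + 16*a1^3*k^3 - 3*a1^4 - 24*b1*d1*k + 6*b1*k^8 + 9*b1^2*k^4 - 4*b1^3 + 8*c1*d1 + k^12) 12 0 0 0 0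
    ∈ Ideal.span ({G8, G10, G12, G14, G18} : Set (MvPolynomial (Fin 5) ℚ))) :
    ∃ m12_10_11 m12_12_ m12_8_1111 m12_8_13 m12_8_4 : ℚ,
    8*c4*d4 + 4*m12_8_13 = 0 ∧
    8*c4*d6 + 4*m12_8_4 = 0 ∧
    -3*a2^4 + 3*m12_12_ = 0 ∧
    -4*b3^3 + 4*m12_12_ - 6*m12_8_4 = 0 ∧
    8*c4*d7 - 8*m12_12_ = 0 ∧
    4*a2*b3^2*k - 12*b2*b3^2 - 24*b3*d6*k + 8*c3*d6 - 4*m12_12_ - 6*m12_8_13 + 12*m12_8_4 = 0 ∧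
    12*a1*d7*k^2 - 24*b1*d7*k + 8*c1*d7 - m12_10_11 - 4*m12_8_1111 = 0 ∧
    -12*a1*b1*k^5 + 4*a1*b1^2*k + 12*a1*d1*k^2 - 4*a1*k^9 - 18*a1^2*b1*k^2 - 2*a1^2*k^6 + 16*a1^3*k^3 - 3*a1^4 - 24*b1*d1*k + 6*b1*k^8 + 9*b1^2*k^4 - 4*b1^3 + 8*c1*d1 + k^12 - m12_12_ - m12_8_1111 = 0 ∧
    8*c4*d5 - m12_10_11 = 0 ∧
    12*a1*d5*k^2 - 24*b1*d5*k + 8*c1*d5 + 8*c4*d1 - 2*m12_8_1111 = 0 := by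
  obtain ⟨p, q, r, s, t, h⟩ := mem_G _ hf
  simp only [G8, G10, G12, G14, G18, mul_add] at h
  refine ⟨cf 2 0 0 0 0 q, cf 0 0 0 0 0 r, cf 4 0 0 0 0 p, cf 1 1 0 0 0 p, cf 0 0 1 0 0 p, ?_, ?_, ?_, ?_, ?_, ?_, ?_, ?_, ?_, ?_⟩
  · have e := congrArg (cf 1 2 0 1 0) h
    simp [cf_add, cf_T, cf_mul_T, -mul_eq_zero, -zero_eq_mul, -pow_eq_zero_iff, -mul_eq_mul_left_iff, -mul_eq_mul_right_iff, -neg_eq_zero, -zero_eq_neg] at e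
    linarith
  · have e := congrArg (cf 0 1 1 1 0) h
    simp [cf_add, cf_T, cf_mul_T, -mul_eq_zero, -zero_eq_mul, -pow_eq_zero_iff, -mul_eq_mul_left_iff, -mul_eq_mul_right_iff, -neg_eq_zero, -zero_eq_neg] at e
    linarith
  · have e := congrArg (cf 0 4 0 0 0) h
    simp [cf_add, cf_T, cf_mul_T, -mul_eq_zero, -zero_eq_mul, -pow_eq_zero_iff, -mul_eq_mul_left_iff, -mul_eq_mul_right_iff, -neg_eq_zero, -zero_eq_neg] at e
    linarith
  · have e := congrArg (cf 0 0 3 0 0) h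
    simp [cf_add, cf_T, cf_mul_T, -mul_eq_zero, -zero_eq_mul, -pow_eq_zero_iff, -mul_eq_mul_left_iff, -mul_eq_mul_right_iff, -neg_eq_zero, -zero_eq_neg] at e
    linarith
  · have e := congrArg (cf 0 0 0 1 1) h
    simp [cf_add, cf_T, cf_mul_T, -mul_eq_zero, -zero_eq_mul, -pow_eq_zero_iff, -mul_eq_mul_left_iff, -mul_eq_mul_right_iff, -neg_eq_zero, -zero_eq_neg] at e
    linarith
  · have e := congrArg (cf 1 1 2 0 0) h
    simp [cf_add, cf_T, cf_mul_T, -mul_eq_zero, -zero_eq_mul, -pow_eq_zero_iff, -mul_eq_mul_left_iff, -mul_eq_mul_right_iff, -neg_eq_zero, -zero_eq_neg] at e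
    linarith
  · have e := congrArg (cf 5 0 0 0 1) h
    simp [cf_add, cf_T, cf_mul_T, -mul_eq_zero, -zero_eq_mul, -pow_eq_zero_iff, -mul_eq_mul_left_iff, -mul_eq_mul_right_iff, -neg_eq_zero, -zero_eq_neg] at e
    linarith
  · have e := congrArg (cf 12 0 0 0 0) h
    simp [cf_add, cf_T, cf_mul_T, -mul_eq_zero, -zero_eq_mul, -pow_eq_zero_iff, -mul_eq_mul_left_iff, -mul_eq_mul_right_iff, -neg_eq_zero, -zero_eq_neg] at e
    linarith
  · have e := congrArg (cf 2 0 0 2 0) h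
    simp [cf_add, cf_T, cf_mul_T, -mul_eq_zero, -zero_eq_mul, -pow_eq_zero_iff, -mul_eq_mul_left_iff, -mul_eq_mul_right_iff, -neg_eq_zero, -zero_eq_neg] at e
    linarith
  · have e := congrArg (cf 7 0 0 1 0) h
    simp [cf_add, cf_T, cf_mul_T, -mul_eq_zero, -zero_eq_mul, -pow_eq_zero_iff, -mul_eq_mul_left_iff, -mul_eq_mul_right_iff, -neg_eq_zero, -zero_eq_neg] at e
    linarith

theorem deg14_coeff (k a1 b1 b2 c1 c2 d1 d2 d3 d4 d5 d6 d7 : ℚ)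
    (hf : T (d7^2) 0 0 0 0 2
    + T (2*d5*d7) 2 0 0 1 1
    + T (2*d6*d7) 0 1 1 0 1
    + T (2*d3*d7) 3 0 1 0 1
    + T (2*d4*d7) 1 2 0 0 1
    + T (-3*c2*d7*k^2 + 2*d2*d7) 4 1 0 0 1
    + T (-3*c1*d7*k^2 + 2*d1*d7) 7 0 0 0 1
    + T (d5^2) 4 0 0 2 0
    + T (2*d5*d6) 2 1 1 1 0
    + T (2*d3*d5) 5 0 1 1 0
    + T (2*d4*d5) 3 2 0 1 0
    + T (-3*c2*d5*k^2 + 2*d2*d5) 6 1 0 1 0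
    + T (-3*c1*d5*k^2 + 2*d1*d5) 9 0 0 1 0
    + T (d6^2) 0 2 2 0 0
    + T (2*d3*d6) 3 1 2 0 0
    + T (d3^2) 6 0 2 0 0
    + T (2*d4*d6) 1 3 1 0 0
    + T (-3*c2*d6*k^2 + 2*d2*d6 + 2*d3*d4) 4 2 1 0 0
    + T (-3*c1*d6*k^2 - 3*c2*d3*k^2 + 2*d1*d6 + 2*d2*d3) 7 1 1 0 0
    + T (-3*c1*d3*k^2 + 2*d1*d3) 10 0 1 0 0
    + T (d4^2) 2 4 0 0 0
    + T (3*b2*c2^2 - b2^2*c2*k - 3*c2*d4*k^2 + 2*d2*d4) 5 3 0 0 0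
    + T (3*a1*b2*c2*k^2 - 2*b1*b2*c2*k + 3*b1*c2^2 + 6*b2*c1*c2 - b2^2*c1*k - 3*c1*d4*k^2 - 3*c2*d2*k^2 + 2*d1*d4 + d2^2) 8 2 0 0 0
    + T (3*a1*b1*c2*k^2 + 3*a1*b2*c1*k^2 + a1*c2*k^6 - 3*a1^2*c2*k^3 + a1^3*c2 - 2*b1*b2*c1*k + 6*b1*c1*c2 - b1^2*c2*k + 3*b2*c1^2 - 3*c1*d2*k^2 - 3*c2*d1*k^2 + 2*d1*d2) 11 1 0 0 0
    + T (3*a1*b1*c1*k^2 + a1*c1*k^6 - 3*a1^2*c1*k^3 + a1^3*c1 + 3*b1*c1^2 - b1^2*c1*k - 3*c1*d1*k^2 + d1^2) 14 0 0 0 0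
    ∈ Ideal.span ({G8, G10, G12, G14, G18} : Set (MvPolynomial (Fin 5) ℚ))) :
    ∃ m14_10_1111 m14_10_13 m14_10_4 m14_12_11 m14_14_ m14_8_111111 m14_8_1113 m14_8_114 m14_8_15 m14_8_33 : ℚ,
    d7^2 - m14_14_ = 0 ∧
    -m14_14_ + 4*m14_8_33 = 0 ∧
    d6^2 - 6*m14_8_33 = 0 ∧
    2*d6*d7 + 2*m14_10_4 = 0 ∧
    -m14_10_4 - 3*m14_14_ = 0 ∧
    2*d4*d7 + 2*m14_10_13 - 4*m14_8_33 = 0 ∧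
    -m14_10_13 + 4*m14_8_15 = 0 ∧
    2*d5*d7 - 8*m14_12_11 + 3*m14_14_ - 4*m14_8_15 = 0 ∧
    d4^2 + 3*m14_12_11 - 9*m14_8_33 = 0 ∧
    4*m14_12_11 - 6*m14_8_114 = 0 ∧
    2*d3*d6 - 4*m14_12_11 - 6*m14_8_1113 + 12*m14_8_114 = 0 ∧
    -3*c2*d7*k^2 + 2*d2*d7 + 2*m14_10_1111 - m14_10_13 - 12*m14_12_11 - 4*m14_8_1113 = 0 ∧
    d5^2 - m14_10_1111 - 2*m14_8_15 = 0 ∧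
    -3*c1*d7*k^2 + 2*d1*d7 - m14_10_1111 - 4*m14_8_111111 = 0 ∧
    d3^2 - 9*m14_12_11 - 6*m14_8_111111 - 3*m14_8_114 = 0 ∧
    3*a1*b2*c2*k^2 - 2*b1*b2*c2*k + 3*b1*c2^2 + 6*b2*c1*c2 - b2^2*c1*k - 3*c1*d4*k^2 - 3*c2*d2*k^2 + 2*d1*d4 + d2^2 + 2*m14_12_11 - 9*m14_8_111111 + 6*m14_8_1113 - m14_8_33 = 0 ∧
    3*a1*b1*c1*k^2 + a1*c1*k^6 - 3*a1^2*c1*k^3 + a1^3*c1 + 3*b1*c1^2 - b1^2*c1*k - 3*c1*d1*k^2 + d1^2 - m14_12_11 - m14_8_111111 = 0 := by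
  obtain ⟨p, q, r, s, t, h⟩ := mem_G _ hf
  simp only [G8, G10, G12, G14, G18, mul_add] at h
  refine ⟨cf 4 0 0 0 0 q, cf 1 1 0 0 0 q, cf 0 0 1 0 0 q, cf 2 0 0 0 0 r, cf 0 0 0 0 0 s, cf 6 0 0 0 0 p, cf 3 1 0 0 0 p, cf 2 0 1 0 0 p, cf 1 0 0 1 0 p, cf 0 2 0 0 0 p, ?_, ?_, ?_, ?_, ?_, ?_, ?_, ?_, ?_, ?_, ?_, ?_, ?_, ?_, ?_, ?_, ?_⟩
  · have e := congrArg (cf 0 0 0 0 2) h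
    simp [cf_add, cf_T, cf_mul_T, -mul_eq_zero, -zero_eq_mul, -pow_eq_zero_iff, -mul_eq_mul_left_iff, -mul_eq_mul_right_iff, -neg_eq_zero, -zero_eq_neg] at e
    linarith
  · have e := congrArg (cf 0 3 0 1 0) h
    simp [cf_add, cf_T, cf_mul_T, -mul_eq_zero, -zero_eq_mul, -pow_eq_zero_iff, -mul_eq_mul_left_iff, -mul_eq_mul_right_iff, -neg_eq_zero, -zero_eq_neg] at e
    linarith
  · have e := congrArg (cf 0 2 2 0 0) h
    simp [cf_add, cf_T, cf_mul_T, -mul_eq_zero, -zero_eq_mul, -pow_eq_zero_iff, -mul_eq_mul_left_iff, -mul_eq_mul_right_iff, -neg_eq_zero, -zero_eq_neg] at e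
    linarith
  · have e := congrArg (cf 0 1 1 0 1) h
    simp [cf_add, cf_T, cf_mul_T, -mul_eq_zero, -zero_eq_mul, -pow_eq_zero_iff, -mul_eq_mul_left_iff, -mul_eq_mul_right_iff, -neg_eq_zero, -zero_eq_neg] at e
    linarith
  · have e := congrArg (cf 0 0 1 2 0) h
    simp [cf_add, cf_T, cf_mul_T, -mul_eq_zero, -zero_eq_mul, -pow_eq_zero_iff, -mul_eq_mul_left_iff, -mul_eq_mul_right_iff, -neg_eq_zero, -zero_eq_neg] at e
    linarith
  · have e := congrArg (cf 1 2 0 0 1) h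
    simp [cf_add, cf_T, cf_mul_T, -mul_eq_zero, -zero_eq_mul, -pow_eq_zero_iff, -mul_eq_mul_left_iff, -mul_eq_mul_right_iff, -neg_eq_zero, -zero_eq_neg] at e
    linarith
  · have e := congrArg (cf 1 1 0 2 0) h
    simp [cf_add, cf_T, cf_mul_T, -mul_eq_zero, -zero_eq_mul, -pow_eq_zero_iff, -mul_eq_mul_left_iff, -mul_eq_mul_right_iff, -neg_eq_zero, -zero_eq_neg] at e
    linarith
  · have e := congrArg (cf 2 0 0 1 1) h
    simp [cf_add, cf_T, cf_mul_T, -mul_eq_zero, -zero_eq_mul, -pow_eq_zero_iff, -mul_eq_mul_left_iff, -mul_eq_mul_right_iff, -neg_eq_zero, -zero_eq_neg] at e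
    linarith
  · have e := congrArg (cf 2 4 0 0 0) h
    simp [cf_add, cf_T, cf_mul_T, -mul_eq_zero, -zero_eq_mul, -pow_eq_zero_iff, -mul_eq_mul_left_iff, -mul_eq_mul_right_iff, -neg_eq_zero, -zero_eq_neg] at e
    linarith
  · have e := congrArg (cf 2 0 3 0 0) h
    simp [cf_add, cf_T, cf_mul_T, -mul_eq_zero, -zero_eq_mul, -pow_eq_zero_iff, -mul_eq_mul_left_iff, -mul_eq_mul_right_iff, -neg_eq_zero, -zero_eq_neg] at e
    linarith
  · have e := congrArg (cf 3 1 2 0 0) h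
    simp [cf_add, cf_T, cf_mul_T, -mul_eq_zero, -zero_eq_mul, -pow_eq_zero_iff, -mul_eq_mul_left_iff, -mul_eq_mul_right_iff, -neg_eq_zero, -zero_eq_neg] at e
    linarith
  · have e := congrArg (cf 4 1 0 0 1) h
    simp [cf_add, cf_T, cf_mul_T, -mul_eq_zero, -zero_eq_mul, -pow_eq_zero_iff, -mul_eq_mul_left_iff, -mul_eq_mul_right_iff, -neg_eq_zero, -zero_eq_neg] at e
    linarith
  · have e := congrArg (cf 4 0 0 2 0) h
    simp [cf_add, cf_T, cf_mul_T, -mul_eq_zero, -zero_eq_mul, -pow_eq_zero_iff, -mul_eq_mul_left_iff, -mul_eq_mul_right_iff, -neg_eq_zero, -zero_eq_neg] at e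
    linarith
  · have e := congrArg (cf 7 0 0 0 1) h
    simp [cf_add, cf_T, cf_mul_T, -mul_eq_zero, -zero_eq_mul, -pow_eq_zero_iff, -mul_eq_mul_left_iff, -mul_eq_mul_right_iff, -neg_eq_zero, -zero_eq_neg] at e
    linarith
  · have e := congrArg (cf 6 0 2 0 0) h
    simp [cf_add, cf_T, cf_mul_T, -mul_eq_zero, -zero_eq_mul, -pow_eq_zero_iff, -mul_eq_mul_left_iff, -mul_eq_mul_right_iff, -neg_eq_zero, -zero_eq_neg] at e
    linarith
  · have e := congrArg (cf 8 2 0 0 0) h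
    simp [cf_add, cf_T, cf_mul_T, -mul_eq_zero, -zero_eq_mul, -pow_eq_zero_iff, -mul_eq_mul_left_iff, -mul_eq_mul_right_iff, -neg_eq_zero, -zero_eq_neg] at e
    linarith
  · have e := congrArg (cf 14 0 0 0 0) h
    simp [cf_add, cf_T, cf_mul_T, -mul_eq_zero, -zero_eq_mul, -pow_eq_zero_iff, -mul_eq_mul_left_iff, -mul_eq_mul_right_iff, -neg_eq_zero, -zero_eq_neg] at e
    linarith

theorem deg18_coeff (E : ℚ)
    (hf : T E 18 0 0 0 0 ∈ Ideal.span ({G8, G10, G12, G14, G18} : Set (MvPolynomial (Fin 5) ℚ))) :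
    E = 0 := by
  obtain ⟨p, q, r, s, t, h⟩ := mem_G _ hf
  simp only [G8, G10, G12, G14, G18, mul_add] at h
  have e0 := congrArg (cf 10 0 2 0 0) h
  simp [cf_add, cf_T, cf_mul_T, -mul_eq_zero, -zero_eq_mul, -pow_eq_zero_iff, -mul_eq_mul_left_iff, -mul_eq_mul_right_iff, -neg_eq_zero, -zero_eq_neg] at e0
  have e1 := congrArg (cf 2 0 4 0 0) h
  simp [cf_add, cf_T, cf_mul_T, -mul_eq_zero, -zero_eq_mul, -pow_eq_zero_iff, -mul_eq_mul_left_iff, -mul_eq_mul_right_iff, -neg_eq_zero, -zero_eq_neg] at e1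
  have e2 := congrArg (cf 3 5 0 0 0) h
  simp [cf_add, cf_T, cf_mul_T, -mul_eq_zero, -zero_eq_mul, -pow_eq_zero_iff, -mul_eq_mul_left_iff, -mul_eq_mul_right_iff, -neg_eq_zero, -zero_eq_neg] at e2
  have e3 := congrArg (cf 1 3 2 0 0) h
  simp [cf_add, cf_T, cf_mul_T, -mul_eq_zero, -zero_eq_mul, -pow_eq_zero_iff, -mul_eq_mul_left_iff, -mul_eq_mul_right_iff, -neg_eq_zero, -zero_eq_neg] at e3
  have e4 := congrArg (cf 2 4 1 0 0) h
  simp [cf_add, cf_T, cf_mul_T, -mul_eq_zero, -zero_eq_mul, -pow_eq_zero_iff, -mul_eq_mul_left_iff, -mul_eq_mul_right_iff, -neg_eq_zero, -zero_eq_neg] at e4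
  have e5 := congrArg (cf 11 1 1 0 0) h
  simp [cf_add, cf_T, cf_mul_T, -mul_eq_zero, -zero_eq_mul, -pow_eq_zero_iff, -mul_eq_mul_left_iff, -mul_eq_mul_right_iff, -neg_eq_zero, -zero_eq_neg] at e5
  have e6 := congrArg (cf 18 0 0 0 0) h
  simp [cf_add, cf_T, cf_mul_T, -mul_eq_zero, -zero_eq_mul, -pow_eq_zero_iff, -mul_eq_mul_left_iff, -mul_eq_mul_right_iff, -neg_eq_zero, -zero_eq_neg] at e6
  have e7 := congrArg (cf 8 2 1 0 0) h
  simp [cf_add, cf_T, cf_mul_T, -mul_eq_zero, -zero_eq_mul, -pow_eq_zero_iff, -mul_eq_mul_left_iff, -mul_eq_mul_right_iff, -neg_eq_zero, -zero_eq_neg] at e7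
  have e8 := congrArg (cf 7 1 2 0 0) h
  simp [cf_add, cf_T, cf_mul_T, -mul_eq_zero, -zero_eq_mul, -pow_eq_zero_iff, -mul_eq_mul_left_iff, -mul_eq_mul_right_iff, -neg_eq_zero, -zero_eq_neg] at e8
  have e9 := congrArg (cf 3 1 3 0 0) h
  simp [cf_add, cf_T, cf_mul_T, -mul_eq_zero, -zero_eq_mul, -pow_eq_zero_iff, -mul_eq_mul_left_iff, -mul_eq_mul_right_iff, -neg_eq_zero, -zero_eq_neg] at e9
  have e10 := congrArg (cf 0 6 0 0 0) h
  simp [cf_add, cf_T, cf_mul_T, -mul_eq_zero, -zero_eq_mul, -pow_eq_zero_iff, -mul_eq_mul_left_iff, -mul_eq_mul_right_iff, -neg_eq_zero, -zero_eq_neg] at e10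
  have e11 := congrArg (cf 0 2 3 0 0) h
  simp [cf_add, cf_T, cf_mul_T, -mul_eq_zero, -zero_eq_mul, -pow_eq_zero_iff, -mul_eq_mul_left_iff, -mul_eq_mul_right_iff, -neg_eq_zero, -zero_eq_neg] at e11
  have e12 := congrArg (cf 15 1 0 0 0) h
  simp [cf_add, cf_T, cf_mul_T, -mul_eq_zero, -zero_eq_mul, -pow_eq_zero_iff, -mul_eq_mul_left_iff, -mul_eq_mul_right_iff, -neg_eq_zero, -zero_eq_neg] at e12
  have e13 := congrArg (cf 4 2 2 0 0) h
  simp [cf_add, cf_T, cf_mul_T, -mul_eq_zero, -zero_eq_mul, -pow_eq_zero_iff, -mul_eq_mul_left_iff, -mul_eq_mul_right_iff, -neg_eq_zero, -zero_eq_neg] at e13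
  linarith

theorem mod5 : ∀ k a b d e : ZMod 5,
    -2*a*e + d^2 + e*k^3 = 0 →
    -12*a*b*k - 4*a*d - 6*a*k^5 + 9*a^2*k^2 + 3*b*k^4 + 6*b^2 + 2*d*k^3 + 4*e*k + k^8 = 0 →
    3*a*b*d*k^2 + a*d*k^6 - 3*a^2*d*k^3 + a^3*d + 3*b*d^2 - b^2*d*k - 3*d*e*k^2 + e^2 = 0 →
    -12*a*b*k^5 + 4*a*b^2*k + 12*a*e*k^2 - 4*a*k^9 - 18*a^2*b*k^2 - 2*a^2*k^6 + 16*a^3*k^3 - 3*a^4 - 24*b*e*k + 6*b*k^8 + 9*b^2*k^4 - 4*b^3 + 8*d*e + k^12 = 0 →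
    8*a*b*d*k^6 - 18*a*b*e*k^4 + 24*a*b^2*d*k^2 - 2*a*b^2*k^7 - 6*a*b^3*k^3 - 8*a*d*e*k^3 + 8*a*d^3 - 6*a*e*k^8 - 24*a^2*b*d*k^3 + 6*a^2*b*k^8 + 15*a^2*b^2*k^4 - 4*a^2*d*e + 18*a^2*e*k^5 + a^2*k^12 + 8*a^3*b*d - 18*a^3*b*k^5 - 2*a^3*b^2*k - 6*a^3*e*k^2 - 6*a^3*k^9 + 6*a^4*b*k^2 + 11*a^4*k^6 - 6*a^5*k^3 + a^6 - 12*b*d*e*k^2 - 4*b*e^2 + 12*b^2*d^2 + 6*b^2*e*k^3 - 8*b^3*d*k + b^4*k^2 + 4*d*e*k^6 - 12*d^2*e*k + 9*e^2*k^4 = 0 →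
    k = 0 ∧ a = 0 ∧ b = 0 ∧ d = 0 ∧ e = 0 := by
  decide +kernel

theorem ladder (k a b d e : ℤ)
    (h8 : -12*a*b*k - 4*a*d - 6*a*k^5 + 9*a^2*k^2 + 3*b*k^4 + 6*b^2 + 2*d*k^3 + 4*e*k + k^8 = 0)
    (h10 : -2*a*e + d^2 + e*k^3 = 0)
    (h12 : -12*a*b*k^5 + 4*a*b^2*k + 12*a*e*k^2 - 4*a*k^9 - 18*a^2*b*k^2 - 2*a^2*k^6 + 16*a^3*k^3 - 3*a^4 - 24*b*e*k + 6*b*k^8 + 9*b^2*k^4 - 4*b^3 + 8*d*e + k^12 = 0)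
    (h14 : 3*a*b*d*k^2 + a*d*k^6 - 3*a^2*d*k^3 + a^3*d + 3*b*d^2 - b^2*d*k - 3*d*e*k^2 + e^2 = 0)
    (h18 : 8*a*b*d*k^6 - 18*a*b*e*k^4 + 24*a*b^2*d*k^2 - 2*a*b^2*k^7 - 6*a*b^3*k^3 - 8*a*d*e*k^3 + 8*a*d^3 - 6*a*e*k^8 - 24*a^2*b*d*k^3 + 6*a^2*b*k^8 + 15*a^2*b^2*k^4 - 4*a^2*d*e + 18*a^2*e*k^5 + a^2*k^12 + 8*a^3*b*d - 18*a^3*b*k^5 - 2*a^3*b^2*k - 6*a^3*e*k^2 - 6*a^3*k^9 + 6*a^4*b*k^2 + 11*a^4*k^6 - 6*a^5*k^3 + a^6 - 12*b*d*e*k^2 - 4*b*e^2 + 12*b^2*d^2 + 6*b^2*e*k^3 - 8*b^3*d*k + b^4*k^2 + 4*d*e*k^6 - 12*d^2*e*k + 9*e^2*k^4 = 0) :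
    ∃ k' a' b' d' e' : ℤ, k = 5 * k' ∧ a = 5 ^ 3 * a' ∧ b = 5 ^ 4 * b' ∧ d = 5 ^ 5 * d' ∧
      e = 5 ^ 7 * e' := by
  have h5 : Prime (5 : ℤ) := by norm_num
  have hm := mod5 k a b d e (by exact_mod_cast congrArg (Int.cast : ℤ → ZMod 5) h10)
    (by exact_mod_cast congrArg (Int.cast : ℤ → ZMod 5) h8)
    (by exact_mod_cast congrArg (Int.cast : ℤ → ZMod 5) h14)
    (by exact_mod_cast congrArg (Int.cast : ℤ → ZMod 5) h12)
    (by exact_mod_cast congrArg (Int.cast : ℤ → ZMod 5) h18)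
  have hd : ∀ x : ℤ, (x : ZMod 5) = 0 → (5 : ℤ) ∣ x := fun x hx => by
    exact_mod_cast (ZMod.intCast_zmod_eq_zero_iff_dvd x 5).1 hx
  obtain ⟨hk, ha, hb, hd', he⟩ := hm
  obtain ⟨k1, rfl⟩ := hd _ hk
  obtain ⟨a1, rfl⟩ := hd _ ha
  obtain ⟨b1, rfl⟩ := hd _ hb
  obtain ⟨d1, rfl⟩ := hd _ hd'
  obtain ⟨e1, rfl⟩ := hd _ he
  have hs : (5 : ℤ) ∣ e1 ^ 2 := ⟨-75*a1*b1*d1*k1^2 - 3125*a1*d1*k1^6 + 375*a1^2*d1*k1^3 - 5*a1^3*d1 - 3*b1*d1^2 + 5*b1^2*d1*k1 + 15*d1*e1*k1^2, by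
    apply mul_left_cancel₀ (show (5 : ℤ) ^ 2 ≠ 0 by norm_num)
    linear_combination 1 * h14⟩
  obtain ⟨e2, rfl⟩ := h5.dvd_of_dvd_pow hs
  clear hs
  have hs : (5 : ℤ) ∣ d1 ^ 2 := ⟨2*a1*e2 - 25*e2*k1^3, by
    apply mul_left_cancel₀ (show (5 : ℤ) ^ 2 ≠ 0 by norm_num)
    linear_combination 1 * h10⟩
  obtain ⟨d2, rfl⟩ := h5.dvd_of_dvd_pow hs
  clear hs
  have hs : (5 : ℤ) ∣ b1 ^ 2 := ⟨12*a1*b1*k1 + 4*a1*d2 + 750*a1*k1^5 - 45*a1^2*k1^2 - 75*b1*k1^4 - b1^2 - 50*d2*k1^3 - 4*e2*k1 - 3125*k1^8, by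
    apply mul_left_cancel₀ (show (5 : ℤ) ^ 2 ≠ 0 by norm_num)
    linear_combination 1 * h8⟩
  obtain ⟨b2, rfl⟩ := h5.dvd_of_dvd_pow hs
  clear hs
  have hs : (5 : ℤ) ∣ e2 ^ 2 := ⟨-75*a1*b2*d2*k1^2 - 625*a1*d2*k1^6 + 75*a1^2*d2*k1^3 - a1^3*d2 - 15*b2*d2^2 + 25*b2^2*d2*k1 + 15*d2*e2*k1^2, by
    apply mul_left_cancel₀ (show (5 : ℤ) ^ 4 ≠ 0 by norm_num)
    linear_combination 1 * h14⟩
  obtain ⟨e3, rfl⟩ := h5.dvd_of_dvd_pow hs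
  clear hs
  have hs : (5 : ℤ) ∣ a1 ^ 4 := ⟨4500*a1*b2*k1^5 - 60*a1*b2^2*k1 - 180*a1*e3*k1^2 + 37500*a1*k1^9 + 270*a1^2*b2*k1^2 + 750*a1^2*k1^6 - 240*a1^3*k1^3 + 2*a1^4 + 360*b2*e3*k1 - 56250*b2*k1^8 - 3375*b2^2*k1^4 + 60*b2^3 - 24*d2*e3 - 234375*k1^12, by
    apply mul_left_cancel₀ (show (5 : ℤ) ^ 4 ≠ 0 by norm_num)
    linear_combination 3 * h12⟩
  obtain ⟨a2, rfl⟩ := h5.dvd_of_dvd_pow hs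
  clear hs
  have hs : (5 : ℤ) ∣ d2 ^ 2 := ⟨2*a2*e3 - 5*e3*k1^3, by
    apply mul_left_cancel₀ (show (5 : ℤ) ^ 4 ≠ 0 by norm_num)
    linear_combination 1 * h10⟩
  obtain ⟨d3, rfl⟩ := h5.dvd_of_dvd_pow hs
  clear hs
  have hs : (5 : ℤ) ∣ e3 ^ 2 := ⟨-75*a2*b2*d3*k1^2 - 625*a2*d3*k1^6 + 375*a2^2*d3*k1^3 - 25*a2^3*d3 - 15*b2*d3^2 + 5*b2^2*d3*k1 + 15*d3*e3*k1^2, by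
    apply mul_left_cancel₀ (show (5 : ℤ) ^ 6 ≠ 0 by norm_num)
    linear_combination 1 * h14⟩
  obtain ⟨e4, rfl⟩ := h5.dvd_of_dvd_pow hs
  clear hs
  have hs : (5 : ℤ) ∣ b2 ^ 2 := ⟨12*a2*b2*k1 + 4*a2*d3 + 150*a2*k1^5 - 45*a2^2*k1^2 - 15*b2*k1^4 - b2^2 - 10*d3*k1^3 - 4*e4*k1 - 125*k1^8, by
    apply mul_left_cancel₀ (show (5 : ℤ) ^ 4 ≠ 0 by norm_num)
    linear_combination 1 * h8⟩
  obtain ⟨b3, rfl⟩ := h5.dvd_of_dvd_pow hs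
  clear hs
  have hs : (5 : ℤ) ∣ e4 ^ 2 := ⟨-15*a2*b3*d3*k1^2 - 25*a2*d3*k1^6 + 15*a2^2*d3*k1^3 - a2^3*d3 - 3*b3*d3^2 + 5*b3^2*d3*k1 + 3*d3*e4*k1^2, by
    apply mul_left_cancel₀ (show (5 : ℤ) ^ 8 ≠ 0 by norm_num)
    linear_combination 1 * h14⟩
  obtain ⟨e5, rfl⟩ := h5.dvd_of_dvd_pow hs
  clear hs
  have hs : (5 : ℤ) ∣ d3 ^ 2 := ⟨2*a2*e5 - 5*e5*k1^3, by
    apply mul_left_cancel₀ (show (5 : ℤ) ^ 6 ≠ 0 by norm_num)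
    linear_combination 1 * h10⟩
  obtain ⟨d4, rfl⟩ := h5.dvd_of_dvd_pow hs
  clear hs
  have hs : (5 : ℤ) ∣ a2 ^ 4 := ⟨180*a2*b3*k1^5 - 12*a2*b3^2*k1 - 36*a2*e5*k1^2 + 300*a2*k1^9 + 54*a2^2*b3*k1^2 + 30*a2^2*k1^6 - 48*a2^3*k1^3 + 2*a2^4 + 72*b3*e5*k1 - 450*b3*k1^8 - 135*b3^2*k1^4 + 12*b3^3 - 24*d4*e5 - 375*k1^12, by
    apply mul_left_cancel₀ (show (5 : ℤ) ^ 8 ≠ 0 by norm_num)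
    linear_combination 3 * h12⟩
  obtain ⟨a3, rfl⟩ := h5.dvd_of_dvd_pow hs
  clear hs
  have hs : (5 : ℤ) ∣ e5 ^ 2 := ⟨-15*a3*b3*d4*k1^2 - 25*a3*d4*k1^6 + 75*a3^2*d4*k1^3 - 25*a3^3*d4 - 3*b3*d4^2 + b3^2*d4*k1 + 3*d4*e5*k1^2, by
    apply mul_left_cancel₀ (show (5 : ℤ) ^ 10 ≠ 0 by norm_num)
    linear_combination 1 * h14⟩
  obtain ⟨e6, rfl⟩ := h5.dvd_of_dvd_pow hs
  clear hs
  have hs : (5 : ℤ) ∣ b3 ^ 2 := ⟨12*a3*b3*k1 + 4*a3*d4 + 30*a3*k1^5 - 45*a3^2*k1^2 - 3*b3*k1^4 - b3^2 - 2*d4*k1^3 - 4*e6*k1 - 5*k1^8, by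
    apply mul_left_cancel₀ (show (5 : ℤ) ^ 6 ≠ 0 by norm_num)
    linear_combination 1 * h8⟩
  obtain ⟨b4, rfl⟩ := h5.dvd_of_dvd_pow hs
  clear hs
  have hs : (5 : ℤ) ∣ d4 ^ 2 := ⟨2*a3*e6 - e6*k1^3, by
    apply mul_left_cancel₀ (show (5 : ℤ) ^ 8 ≠ 0 by norm_num)
    linear_combination 1 * h10⟩
  obtain ⟨d5, rfl⟩ := h5.dvd_of_dvd_pow hs
  clear hs
  have hs : (5 : ℤ) ∣ e6 ^ 2 := ⟨-15*a3*b4*d5*k1^2 - 5*a3*d5*k1^6 + 15*a3^2*d5*k1^3 - 5*a3^3*d5 - 15*b4*d5^2 + 5*b4^2*d5*k1 + 3*d5*e6*k1^2, by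
    apply mul_left_cancel₀ (show (5 : ℤ) ^ 12 ≠ 0 by norm_num)
    linear_combination 1 * h14⟩
  obtain ⟨e7, rfl⟩ := h5.dvd_of_dvd_pow hs
  clear hs
  exact ⟨k1, a3, b4, d5, e7, by ring, by ring, by ring, by ring, by ring⟩

set_option maxHeartbeats 1000000 in
theorem int_points (n : ℕ) : ∀ (k a b d e : ℤ)
    (_ : -12*a*b*k - 4*a*d - 6*a*k^5 + 9*a^2*k^2 + 3*b*k^4 + 6*b^2 + 2*d*k^3 + 4*e*k + k^8 = 0)
    (_ : -2*a*e + d^2 + e*k^3 = 0)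
    (_ : -12*a*b*k^5 + 4*a*b^2*k + 12*a*e*k^2 - 4*a*k^9 - 18*a^2*b*k^2 - 2*a^2*k^6 + 16*a^3*k^3 - 3*a^4 - 24*b*e*k + 6*b*k^8 + 9*b^2*k^4 - 4*b^3 + 8*d*e + k^12 = 0)
    (_ : 3*a*b*d*k^2 + a*d*k^6 - 3*a^2*d*k^3 + a^3*d + 3*b*d^2 - b^2*d*k - 3*d*e*k^2 + e^2 = 0)
    (_ : 8*a*b*d*k^6 - 18*a*b*e*k^4 + 24*a*b^2*d*k^2 - 2*a*b^2*k^7 - 6*a*b^3*k^3 - 8*a*d*e*k^3 + 8*a*d^3 - 6*a*e*k^8 - 24*a^2*b*d*k^3 + 6*a^2*b*k^8 + 15*a^2*b^2*k^4 - 4*a^2*d*e + 18*a^2*e*k^5 + a^2*k^12 + 8*a^3*b*d - 18*a^3*b*k^5 - 2*a^3*b^2*k - 6*a^3*e*k^2 - 6*a^3*k^9 + 6*a^4*b*k^2 + 11*a^4*k^6 - 6*a^5*k^3 + a^6 - 12*b*d*e*k^2 - 4*b*e^2 + 12*b^2*d^2 + 6*b^2*e*k^3 - 8*b^3*d*k +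 b^4*k^2 + 4*d*e*k^6 - 12*d^2*e*k + 9*e^2*k^4 = 0),
    (5 : ℤ) ^ n ∣ k ∧ (5 : ℤ) ^ n ∣ a ∧ (5 : ℤ) ^ n ∣ b ∧ (5 : ℤ) ^ n ∣ d ∧ (5 : ℤ) ^ n ∣ e := by
  induction n with
  | zero => intros; simp
  | succ n ih =>
    intro k a b d e h8 h10 h12 h14 h18
    obtain ⟨k', a', b', d', e', rfl, rfl, rfl, rfl, rfl⟩ := ladder k a b d e h8 h10 h12 h14 h18
    have f8 : -12*a'*b'*k' - 4*a'*d' - 6*a'*k'^5 + 9*a'^2*k'^2 + 3*b'*k'^4 + 6*b'^2 + 2*d'*k'^3 + 4*e'*k' + k'^8 = 0 := by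
      apply mul_left_cancel₀ (show (5 : ℤ) ^ 8 ≠ 0 by norm_num)
      linear_combination h8
    have f10 : -2*a'*e' + d'^2 + e'*k'^3 = 0 := by
      apply mul_left_cancel₀ (show (5 : ℤ) ^ 10 ≠ 0 by norm_num)
      linear_combination h10
    have f12 : -12*a'*b'*k'^5 + 4*a'*b'^2*k' + 12*a'*e'*k'^2 - 4*a'*k'^9 - 18*a'^2*b'*k'^2 - 2*a'^2*k'^6 + 16*a'^3*k'^3 - 3*a'^4 - 24*b'*e'*k' + 6*b'*k'^8 + 9*b'^2*k'^4 - 4*b'^3 + 8*d'*e' + k'^12 = 0 := by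
      apply mul_left_cancel₀ (show (5 : ℤ) ^ 12 ≠ 0 by norm_num)
      linear_combination h12
    have f14 : 3*a'*b'*d'*k'^2 + a'*d'*k'^6 - 3*a'^2*d'*k'^3 + a'^3*d' + 3*b'*d'^2 - b'^2*d'*k' - 3*d'*e'*k'^2 + e'^2 = 0 := by
      apply mul_left_cancel₀ (show (5 : ℤ) ^ 14 ≠ 0 by norm_num)
      linear_combination h14
    have f18 : 8*a'*b'*d'*k'^6 - 18*a'*b'*e'*k'^4 + 24*a'*b'^2*d'*k'^2 - 2*a'*b'^2*k'^7 - 6*a'*b'^3*k'^3 - 8*a'*d'*e'*k'^3 + 8*a'*d'^3 - 6*a'*e'*k'^8 - 24*a'^2*b'*d'*k'^3 + 6*a'^2*b'*k'^8 + 15*a'^2*b'^2*k'^4 - 4*a'^2*d'*e' + 18*a'^2*e'*k'^5 + a'^2*k'^12 + 8*a'^3*b'*d' - 18*a'^3*b'*k'^5 - 2*a'^3*b'^2*k' - 6*a'^3*e'*k'^2 - 6*a'^3*k'^9 + 6*a'^4*b'*k'^2 + 11*a'^4*k'^6 - 6*a'^5*k'^3 + a'^6 - 12*b'*d'*e'*k'^2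 - 4*b'*e'^2 + 12*b'^2*d'^2 + 6*b'^2*e'*k'^3 - 8*b'^3*d'*k' + b'^4*k'^2 + 4*d'*e'*k'^6 - 12*d'^2*e'*k' + 9*e'^2*k'^4 = 0 := by
      apply mul_left_cancel₀ (show (5 : ℤ) ^ 18 ≠ 0 by norm_num)
      linear_combination h18
    obtain ⟨⟨k, rfl⟩, ⟨a, rfl⟩, ⟨b, rfl⟩, ⟨d, rfl⟩, ⟨e, rfl⟩⟩ := ih k' a' b' d' e' f8 f10 f12 f14 f18
    exact ⟨⟨k, by ring⟩, ⟨5 ^ 2 * a, by ring⟩, ⟨5 ^ 3 * b, by ring⟩, ⟨5 ^ 4 * d, by ring⟩,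
      ⟨5 ^ 6 * e, by ring⟩⟩

theorem int_eq_zero (x : ℤ) (h : ∀ n : ℕ, (5 : ℤ) ^ n ∣ x) : x = 0 := by
  by_contra hx
  have h1 := Int.le_of_dvd (abs_pos.2 hx) ((dvd_abs _ _).2 (h x.natAbs))
  have h2 : x.natAbs < 5 ^ x.natAbs := Nat.lt_pow_self (by norm_num)
  have h3 : ((x.natAbs : ℕ) : ℤ) < 5 ^ x.natAbs := by exact_mod_cast h2
  rw [Int.natCast_natAbs] at h3
  omega

theorem scale_int (x : ℚ) (N w : ℕ) (hw : w ≠ 0) (h : x.den ∣ N) :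
    ∃ z : ℤ, (z : ℚ) = (N : ℚ) ^ w * x := by
  obtain ⟨w, rfl⟩ := Nat.exists_eq_succ_of_ne_zero hw
  obtain ⟨c, rfl⟩ := h
  refine ⟨(x.den * c : ℤ) ^ w * c * x.num, ?_⟩
  push_cast
  have := Rat.mul_den_eq_num x
  rw [Nat.succ_eq_add_one, pow_succ]
  linear_combination (-((x.den : ℚ) * c) ^ w * c) * this

theorem rat_points (k a b d e : ℚ)
    (h8 : -12*a*b*k - 4*a*d - 6*a*k^5 + 9*a^2*k^2 + 3*b*k^4 + 6*b^2 + 2*d*k^3 + 4*e*k + k^8 = 0)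
    (h10 : -2*a*e + d^2 + e*k^3 = 0)
    (h12 : -12*a*b*k^5 + 4*a*b^2*k + 12*a*e*k^2 - 4*a*k^9 - 18*a^2*b*k^2 - 2*a^2*k^6 + 16*a^3*k^3 - 3*a^4 - 24*b*e*k + 6*b*k^8 + 9*b^2*k^4 - 4*b^3 + 8*d*e + k^12 = 0)
    (h14 : 3*a*b*d*k^2 + a*d*k^6 - 3*a^2*d*k^3 + a^3*d + 3*b*d^2 - b^2*d*k - 3*d*e*k^2 + e^2 = 0)
    (h18 : 8*a*b*d*k^6 - 18*a*b*e*k^4 + 24*a*b^2*d*k^2 - 2*a*b^2*k^7 - 6*a*b^3*k^3 - 8*a*d*e*k^3 + 8*a*d^3 - 6*a*e*k^8 - 24*a^2*b*d*k^3 + 6*a^2*b*k^8 + 15*a^2*b^2*k^4 - 4*a^2*d*e + 18*a^2*e*k^5 + a^2*k^12 + 8*a^3*b*d - 18*a^3*b*k^5 - 2*a^3*b^2*k - 6*a^3*e*k^2 - 6*a^3*k^9 + 6*a^4*b*k^2 + 11*a^4*k^6 - 6*a^5*k^3 + a^6 - 12*b*d*e*k^2 - 4*b*e^2 + 12*b^2*d^2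 + 6*b^2*e*k^3 - 8*b^3*d*k + b^4*k^2 + 4*d*e*k^6 - 12*d^2*e*k + 9*e^2*k^4 = 0) :
    k = 0 ∧ a = 0 ∧ b = 0 ∧ d = 0 ∧ e = 0 := by
  set N : ℕ := k.den * a.den * b.den * d.den * e.den with hN
  have hN0 : (N : ℚ) ≠ 0 := by simp [hN]
  obtain ⟨K, hK⟩ := scale_int k N 1 (by norm_num) ⟨a.den * b.den * d.den * e.den, by rw [hN]; ring⟩
  obtain ⟨A, hA⟩ := scale_int a N 3 (by norm_num) ⟨k.den * b.den * d.den * e.den, by rw [hN]; ring⟩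
  obtain ⟨B, hB⟩ := scale_int b N 4 (by norm_num) ⟨k.den * a.den * d.den * e.den, by rw [hN]; ring⟩
  obtain ⟨D, hD⟩ := scale_int d N 5 (by norm_num) ⟨k.den * a.den * b.den * e.den, by rw [hN]; ring⟩
  obtain ⟨E, hE⟩ := scale_int e N 7 (by norm_num) ⟨k.den * a.den * b.den * d.den, by rw [hN]; ring⟩
  clear_value N
  have key := fun n : ℕ => int_points n K A B D E
    (by
      have : (((-12*A*B*K - 4*A*D - 6*A*K^5 + 9*A^2*K^2 + 3*B*K^4 + 6*B^2 + 2*D*K^3 + 4*E*K + K^8 : ℤ)) : ℚ) = 0 := by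
        push_cast
        simp only [hK, hA, hB, hD, hE]
        linear_combination (N : ℚ) ^ 8 * h8
      exact_mod_cast this)
    (by
      have : (((-2*A*E + D^2 + E*K^3 : ℤ)) : ℚ) = 0 := by
        push_cast
        simp only [hK, hA, hB, hD, hE]
        linear_combination (N : ℚ) ^ 10 * h10
      exact_mod_cast this)
    (by
      have : (((-12*A*B*K^5 + 4*A*B^2*K + 12*A*E*K^2 - 4*A*K^9 - 18*A^2*B*K^2 - 2*A^2*K^6 + 16*A^3*K^3 - 3*A^4 - 24*B*E*K + 6*B*K^8 + 9*B^2*K^4 - 4*B^3 + 8*D*E + K^12 : ℤ)) : ℚ) = 0 := by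
        push_cast
        simp only [hK, hA, hB, hD, hE]
        linear_combination (N : ℚ) ^ 12 * h12
      exact_mod_cast this)
    (by
      have : (((3*A*B*D*K^2 + A*D*K^6 - 3*A^2*D*K^3 + A^3*D + 3*B*D^2 - B^2*D*K - 3*D*E*K^2 + E^2 : ℤ)) : ℚ) = 0 := by
        push_cast
        simp only [hK, hA, hB, hD, hE]
        linear_combination (N : ℚ) ^ 14 * h14
      exact_mod_cast this)
    (by
      have : (((8*A*B*D*K^6 - 18*A*B*E*K^4 + 24*A*B^2*D*K^2 - 2*A*B^2*K^7 - 6*A*B^3*K^3 - 8*A*D*E*K^3 + 8*A*D^3 - 6*A*E*K^8 - 24*A^2*B*D*K^3 + 6*A^2*B*K^8 + 15*A^2*B^2*K^4 - 4*A^2*D*E + 18*A^2*E*K^5 + A^2*K^12 + 8*A^3*B*D - 18*A^3*B*K^5 - 2*A^3*B^2*K - 6*A^3*E*K^2 - 6*A^3*K^9 + 6*A^4*B*K^2 + 11*A^4*K^6 - 6*A^5*K^3 + A^6 - 12*B*D*E*K^2 - 4*B*E^2 + 12*B^2*D^2 + 6*B^2*E*K^3 - 8*B^3*D*K + B^4*K^2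 + 4*D*E*K^6 - 12*D^2*E*K + 9*E^2*K^4 : ℤ)) : ℚ) = 0 := by
        push_cast
        simp only [hK, hA, hB, hD, hE]
        linear_combination (N : ℚ) ^ 18 * h18
      exact_mod_cast this)
  have zK := int_eq_zero K fun n => (key n).1
  have zA := int_eq_zero A fun n => (key n).2.1
  have zB := int_eq_zero B fun n => (key n).2.2.1
  have zD := int_eq_zero D fun n => (key n).2.2.2.1
  have zE := int_eq_zero E fun n => (key n).2.2.2.2
  subst zK zA zB zD zE
  simp [hN0] at hK hA hB hD hE
  exact ⟨hK, hA, hB, hD, hE⟩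

end E7Aux

open E7Aux


set_option maxHeartbeats 1600000 in
/-- Rigidity computation for `X = E₇/A₇·S¹`. -/
theorem E7_A7_rigidity (k a1 a2 b1 b2 b3 c1 c2 c3 c4 d1 d2 d3 d4 d5 d6 d7 : ℚ)
    (y1 y3 y4 y5 y7 g8 g10 g12 g14 g18 : MvPolynomial (Fin 5) ℚ)
    (hy1 : y1 = X 0) (hy3 : y3 = X 1) (hy4 : y4 = X 2) (hy5 : y5 = X 3) (hy7 : y7 = X 4)
    (hg8 : g8 = 6 * y4 ^ 2 - 4 * y3 * y5 + 4 * y1 * y7 - 12 * y1 * y3 * y4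
      + 9 * y1 ^ 2 * y3 ^ 2 + 2 * y1 ^ 3 * y5 + 3 * y1 ^ 4 * y4 - 6 * y1 ^ 5 * y3 + y1 ^ 8)
    (hg10 : g10 = y5 ^ 2 - 2 * y3 * y7 + y1 ^ 3 * y7)
    (hg12 : g12 = -4 * y4 ^ 3 - 2 * y3 ^ 2 * y1 ^ 6 + 9 * y1 ^ 4 * y4 ^ 2 + 6 * y1 ^ 8 * y4
      - 4 * y1 ^ 9 * y3 - 24 * y1 * y4 * y7 - 12 * y1 ^ 5 * y4 * y3 + 8 * y5 * y7
      + 4 * y3 * y1 * y4 ^ 2 - 18 * y3 ^ 2 * y1 ^ 2 * y4 + 12 * y3 * y1 ^ 2 * y7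
      - 3 * y3 ^ 4 + y1 ^ 12 + 16 * y3 ^ 3 * y1 ^ 3)
    (hg14 : g14 = y7 ^ 2 + 3 * y4 * y5 ^ 2 + y5 * y3 ^ 3 + 3 * y5 * y3 * y1 ^ 2 * y4
      - 3 * y5 * y1 ^ 3 * y3 ^ 2 + y5 * y3 * y1 ^ 6 - y5 * y1 * y4 ^ 2
      - 3 * y5 * y1 ^ 2 * y7)
    (hg18 : g18 = -8 * y4 ^ 3 * y5 * y1 - 4 * y5 * y7 * y3 ^ 2 - 2 * y3 * y1 ^ 7 * y4 ^ 2
      + y3 ^ 6 - 6 * y3 * y1 ^ 8 * y7 + 18 * y1 ^ 5 * y3 ^ 2 * y7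
      + 15 * y3 ^ 2 * y1 ^ 4 * y4 ^ 2 - 6 * y3 * y1 ^ 3 * y4 ^ 3
      + 8 * y4 * y5 * y3 * y1 ^ 6 - 12 * y1 * y5 ^ 2 * y7 + y1 ^ 2 * y4 ^ 4
      + 12 * y4 ^ 2 * y5 ^ 2 + y3 ^ 2 * y1 ^ 12 - 6 * y1 ^ 9 * y3 ^ 3
      + 11 * y3 ^ 4 * y1 ^ 6 + 8 * y4 * y5 * y3 ^ 3 + 24 * y4 ^ 2 * y5 * y3 * y1 ^ 2
      + 8 * y3 * y5 ^ 3 - 18 * y3 ^ 3 * y1 ^ 5 * y4 - 2 * y3 ^ 3 * y1 * y4 ^ 2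
      + 4 * y5 * y7 * y1 ^ 6 + 6 * y3 ^ 4 * y1 ^ 2 * y4 - 6 * y3 ^ 5 * y1 ^ 3
      + 6 * y1 ^ 3 * y4 ^ 2 * y7 - 18 * y3 * y1 ^ 4 * y4 * y7 - 6 * y3 ^ 3 * y1 ^ 2 * y7
      + 6 * y3 ^ 2 * y1 ^ 8 * y4 - 4 * y4 * y7 ^ 2 + 9 * y1 ^ 4 * y7 ^ 2
      - 24 * y4 * y5 * y1 ^ 3 * y3 ^ 2 - 8 * y5 * y7 * y1 ^ 3 * y3
      - 12 * y4 * y5 * y1 ^ 2 * y7)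
    (I : Ideal (MvPolynomial (Fin 5) ℚ)) (hI : I = Ideal.span {g8, g10, g12, g14, g18})
    (φ : MvPolynomial (Fin 5) ℚ →ₐ[ℚ] MvPolynomial (Fin 5) ℚ)
    (hφ1 : φ y1 = C k * y1)
    (hφ3 : φ y3 = C a1 * y1 ^ 3 + C a2 * y3)
    (hφ4 : φ y4 = C b1 * y1 ^ 4 + C b2 * y1 * y3 + C b3 * y4)
    (hφ5 : φ y5 = C c1 * y1 ^ 5 + C c2 * y1 ^ 2 * y3 + C c3 * y1 * y4 + C c4 * y5)
    (hφ7 : φ y7 = C d1 * y1 ^ 7 + C d2 * y1 ^ 4 * y3 + C d3 * y1 ^ 3 * y4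
      + C d4 * y1 * y3 ^ 2 + C d5 * y1 ^ 2 * y5 + C d6 * y3 * y4 + C d7 * y7)
    (h8 : φ g8 ∈ I) (h10 : φ g10 ∈ I) (h12 : φ g12 ∈ I) (h14 : φ g14 ∈ I)
    (h18 : φ g18 ∈ I) :
    a1 = 0 ∧ b1 = 0 ∧ b2 = 0 ∧ c1 = 0 ∧ c2 = 0 ∧ c3 = 0 ∧ d1 = 0 ∧ d2 = 0 ∧ d3 = 0 ∧
    d4 = 0 ∧ d5 = 0 ∧ d6 = 0 ∧ a2 = k ^ 3 ∧ b3 = k ^ 4 ∧ c4 = k ^ 5 ∧ d7 = k ^ 7 := by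
  have q8 : g8 = G8 := by
    rw [hg8]
    simp only [hy1, hy3, hy4, hy5, hy7, G8, T_eq, map_neg, map_ofNat, map_one]
    ring
  have q10 : g10 = G10 := by
    rw [hg10]
    simp only [hy1, hy3, hy4, hy5, hy7, G10, T_eq, map_neg, map_ofNat, map_one]
    ring
  have q12 : g12 = G12 := by
    rw [hg12]
    simp only [hy1, hy3, hy4, hy5, hy7, G12, T_eq, map_neg, map_ofNat, map_one]
    ring
  have q14 : g14 = G14 := by
    rw [hg14]
    simp only [hy1, hy3, hy4, hy5, hy7, G14, T_eq, map_neg, map_ofNat, map_one]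
    ring
  have q18 : g18 = G18 := by
    rw [hg18]
    simp only [hy1, hy3, hy4, hy5, hy7, G18, T_eq, map_neg, map_ofNat, map_one]
    ring
  have hJ : I = Ideal.span ({G8, G10, G12, G14, G18} : Set (MvPolynomial (Fin 5) ℚ)) := by
    rw [hI, q8, q10, q12, q14, q18]
  clear q8 q10 q12 q14 q18
  have f8 : φ g8 = T (4*d7*k) 1 0 0 0 1
    + T (-4*a2*c4) 0 1 0 1 0
    + T (-4*a1*c4 + 2*c4*k^3 + 4*d5*k) 3 0 0 1 0
    + T (6*b3^2) 0 0 2 0 0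
    + T (-12*a2*b3*k - 4*a2*c3 + 12*b2*b3 + 4*d6*k) 1 1 1 0 0
    + T (-12*a1*b3*k - 4*a1*c3 + 12*b1*b3 + 3*b3*k^4 + 2*c3*k^3 + 4*d3*k) 4 0 1 0 0
    + T (-12*a2*b2*k - 4*a2*c2 + 9*a2^2*k^2 + 6*b2^2 + 4*d4*k) 2 2 0 0 0
    + T (18*a1*a2*k^2 - 12*a1*b2*k - 4*a1*c2 - 12*a2*b1*k - 4*a2*c1 - 6*a2*k^5 + 12*b1*b2 + 3*b2*k^4 + 2*c2*k^3 + 4*d2*k) 5 1 0 0 0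
    + T (-12*a1*b1*k - 4*a1*c1 - 6*a1*k^5 + 9*a1^2*k^2 + 3*b1*k^4 + 6*b1^2 + 2*c1*k^3 + 4*d1*k + k^8) 8 0 0 0 0 := by
    rw [hg8]
    simp only [map_add, map_sub, map_mul, map_pow, map_neg, map_ofNat, hφ1, hφ3, hφ4, hφ5, hφ7]
    simp only [hy1, hy3, hy4, hy5, hy7, T_eq, map_add, map_sub, map_mul, map_pow, map_neg, map_ofNat, map_zero, map_one]
    ring
  rw [f8, hJ] at h8
  obtain ⟨m8_8_, e8_1_0_0_0_1, e8_0_1_0_1_0, e8_3_0_0_1_0, e8_0_0_2_0_0, e8_1_1_1_0_0, e8_4_0_1_0_0, e8_2_2_0_0_0, e8_5_1_0_0_0, e8_8_0_0_0_0⟩ := deg8_coeff k a1 a2 b1 b2 b3 c1 c2 c3 c4 d1 d2 d3 d4 d5 d6 d7 h8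
  have f10 : φ g10 = T (-2*a2*d7) 0 1 0 0 1
    + T (-2*a1*d7 + d7*k^3) 3 0 0 0 1
    + T (c4^2) 0 0 0 2 0
    + T (2*c3*c4) 1 0 1 1 0
    + T (-2*a2*d5 + 2*c2*c4) 2 1 0 1 0
    + T (-2*a1*d5 + 2*c1*c4 + d5*k^3) 5 0 0 1 0
    + T (c3^2) 2 0 2 0 0
    + T (-2*a2*d6) 0 2 1 0 0
    + T (-2*a1*d6 - 2*a2*d3 + 2*c2*c3 + d6*k^3) 3 1 1 0 0
    + T (-2*a1*d3 + 2*c1*c3 + d3*k^3) 6 0 1 0 0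
    + T (-2*a2*d4) 1 3 0 0 0
    + T (-2*a1*d4 - 2*a2*d2 + c2^2 + d4*k^3) 4 2 0 0 0
    + T (-2*a1*d2 - 2*a2*d1 + 2*c1*c2 + d2*k^3) 7 1 0 0 0
    + T (-2*a1*d1 + c1^2 + d1*k^3) 10 0 0 0 0 := by
    rw [hg10]
    simp only [map_add, map_sub, map_mul, map_pow, map_neg, map_ofNat, hφ1, hφ3, hφ4, hφ5, hφ7]
    simp only [hy1, hy3, hy4, hy5, hy7, T_eq, map_add, map_sub, map_mul, map_pow, map_neg, map_ofNat, map_zero, map_one]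
    ring
  rw [f10, hJ] at h10
  obtain ⟨m10_10_, m10_8_11, e10_0_1_0_0_1, e10_3_0_0_0_1, e10_0_0_0_2_0, e10_1_0_1_1_0, e10_2_1_0_1_0, e10_5_0_0_1_0, e10_2_0_2_0_0, e10_0_2_1_0_0, e10_3_1_1_0_0, e10_6_0_1_0_0, e10_1_3_0_0_0, e10_4_2_0_0_0, e10_7_1_0_0_0, e10_10_0_0_0_0⟩ := deg10_coeff k a1 a2 c1 c2 c3 c4 d1 d2 d3 d4 d5 d6 d7 h10
  have f12 : φ g12 = T (8*c4*d7) 0 0 0 1 1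
    + T (-24*b3*d7*k + 8*c3*d7) 1 0 1 0 1
    + T (12*a2*d7*k^2 - 24*b2*d7*k + 8*c2*d7) 2 1 0 0 1
    + T (12*a1*d7*k^2 - 24*b1*d7*k + 8*c1*d7) 5 0 0 0 1
    + T (8*c4*d5) 2 0 0 2 0
    + T (8*c4*d6) 0 1 1 1 0
    + T (-24*b3*d5*k + 8*c3*d5 + 8*c4*d3) 3 0 1 1 0
    + T (8*c4*d4) 1 2 0 1 0
    + T (12*a2*d5*k^2 - 24*b2*d5*k + 8*c2*d5 + 8*c4*d2) 4 1 0 1 0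
    + T (12*a1*d5*k^2 - 24*b1*d5*k + 8*c1*d5 + 8*c4*d1) 7 0 0 1 0
    + T (-4*b3^3) 0 0 3 0 0
    + T (4*a2*b3^2*k - 12*b2*b3^2 - 24*b3*d6*k + 8*c3*d6) 1 1 2 0 0
    + T (4*a1*b3^2*k - 12*b1*b3^2 - 24*b3*d3*k + 9*b3^2*k^4 + 8*c3*d3) 4 0 2 0 0
    + T (8*a2*b2*b3*k + 12*a2*d6*k^2 - 18*a2^2*b3*k^2 - 24*b2*d6*k - 12*b2^2*b3 - 24*b3*d4*k + 8*c2*d6 + 8*c3*d4) 2 2 1 0 0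
    + T (-36*a1*a2*b3*k^2 + 8*a1*b2*b3*k + 12*a1*d6*k^2 + 8*a2*b1*b3*k - 12*a2*b3*k^5 + 12*a2*d3*k^2 - 24*b1*b2*b3 - 24*b1*d6*k + 18*b2*b3*k^4 - 24*b2*d3*k - 24*b3*d2*k + 8*c1*d6 + 8*c2*d3 + 8*c3*d2) 5 1 1 0 0
    + T (8*a1*b1*b3*k - 12*a1*b3*k^5 + 12*a1*d3*k^2 - 18*a1^2*b3*k^2 + 18*b1*b3*k^4 - 24*b1*d3*k - 12*b1^2*b3 - 24*b3*d1*k + 6*b3*k^8 + 8*c1*d3 + 8*c3*d1) 8 0 1 0 0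
    + T (-3*a2^4) 0 4 0 0 0
    + T (-12*a1*a2^3 + 4*a2*b2^2*k + 12*a2*d4*k^2 - 18*a2^2*b2*k^2 + 16*a2^3*k^3 - 24*b2*d4*k - 4*b2^3 + 8*c2*d4) 3 3 0 0 0
    + T (-36*a1*a2*b2*k^2 + 48*a1*a2^2*k^3 + 4*a1*b2^2*k + 12*a1*d4*k^2 - 18*a1^2*a2^2 + 8*a2*b1*b2*k - 12*a2*b2*k^5 + 12*a2*d2*k^2 - 18*a2^2*b1*k^2 - 2*a2^2*k^6 - 12*b1*b2^2 - 24*b1*d4*k - 24*b2*d2*k + 9*b2^2*k^4 + 8*c1*d4 + 8*c2*d2) 6 2 0 0 0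
    + T (-36*a1*a2*b1*k^2 - 4*a1*a2*k^6 + 8*a1*b1*b2*k - 12*a1*b2*k^5 + 12*a1*d2*k^2 + 48*a1^2*a2*k^3 - 18*a1^2*b2*k^2 - 12*a1^3*a2 - 12*a2*b1*k^5 + 4*a2*b1^2*k + 12*a2*d1*k^2 - 4*a2*k^9 + 18*b1*b2*k^4 - 24*b1*d2*k - 12*b1^2*b2 - 24*b2*d1*k + 6*b2*k^8 + 8*c1*d2 + 8*c2*d1) 9 1 0 0 0
    + T (-12*a1*b1*k^5 + 4*a1*b1^2*k + 12*a1*d1*k^2 - 4*a1*k^9 - 18*a1^2*b1*k^2 - 2*a1^2*k^6 + 16*a1^3*k^3 - 3*a1^4 - 24*b1*d1*k + 6*b1*k^8 + 9*b1^2*k^4 - 4*b1^3 + 8*c1*d1 + k^12) 12 0 0 0 0 := by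
    rw [hg12]
    simp only [map_add, map_sub, map_mul, map_pow, map_neg, map_ofNat, hφ1, hφ3, hφ4, hφ5, hφ7]
    simp only [hy1, hy3, hy4, hy5, hy7, T_eq, map_add, map_sub, map_mul, map_pow, map_neg, map_ofNat, map_zero, map_one]
    ring
  rw [f12, hJ] at h12
  obtain ⟨m12_10_11, m12_12_, m12_8_1111, m12_8_13, m12_8_4, e12_1_2_0_1_0, e12_0_1_1_1_0, e12_0_4_0_0_0, e12_0_0_3_0_0, e12_0_0_0_1_1, e12_1_1_2_0_0, e12_5_0_0_0_1, e12_12_0_0_0_0, e12_2_0_0_2_0, e12_7_0_0_1_0⟩ := deg12_coeff k a1 a2 b1 b2 b3 c1 c2 c3 c4 d1 d2 d3 d4 d5 d6 d7 h12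
  clear f8 f10 f12 h8 h10 h12
  by_cases hl : m8_8_ = 0
  · subst hl
    obtain rfl : b3 = 0 := by
      have : b3 ^ 2 = 0 := by linear_combination (1 / 6) * e8_0_0_2_0_0
      exact pow_eq_zero_iff (two_ne_zero) |>.1 this
    obtain rfl : c4 = 0 := by
      have : c4 ^ 3 = 0 := by
        linear_combination c4 * (e10_0_0_0_2_0) + (c4 / 2) * (e10_0_1_0_0_1) - (d7 / 4) * (e8_0_1_0_1_0)
      exact pow_eq_zero_iff (three_ne_zero) |>.1 this
    obtain rfl : a2 = 0 := by
      have : a2 ^ 4 = 0 := by linear_combination (-1 / 3) * e12_0_4_0_0_0 - (1 / 8) * e12_0_0_0_1_1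
      exact pow_eq_zero_iff (four_ne_zero) |>.1 this
    obtain rfl : c3 = 0 := by
      have : c3 ^ 2 = 0 := by linear_combination e10_2_0_2_0_0 + (6 / 4) * e10_2_1_0_1_0
      exact pow_eq_zero_iff (two_ne_zero) |>.1 this
    have f14 : φ g14 = T (d7^2) 0 0 0 0 2
    + T (2*d5*d7) 2 0 0 1 1
    + T (2*d6*d7) 0 1 1 0 1
    + T (2*d3*d7) 3 0 1 0 1
    + T (2*d4*d7) 1 2 0 0 1
    + T (-3*c2*d7*k^2 + 2*d2*d7) 4 1 0 0 1
    + T (-3*c1*d7*k^2 + 2*d1*d7) 7 0 0 0 1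
    + T (d5^2) 4 0 0 2 0
    + T (2*d5*d6) 2 1 1 1 0
    + T (2*d3*d5) 5 0 1 1 0
    + T (2*d4*d5) 3 2 0 1 0
    + T (-3*c2*d5*k^2 + 2*d2*d5) 6 1 0 1 0
    + T (-3*c1*d5*k^2 + 2*d1*d5) 9 0 0 1 0
    + T (d6^2) 0 2 2 0 0
    + T (2*d3*d6) 3 1 2 0 0
    + T (d3^2) 6 0 2 0 0
    + T (2*d4*d6) 1 3 1 0 0
    + T (-3*c2*d6*k^2 + 2*d2*d6 + 2*d3*d4) 4 2 1 0 0
    + T (-3*c1*d6*k^2 - 3*c2*d3*k^2 + 2*d1*d6 + 2*d2*d3) 7 1 1 0 0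
    + T (-3*c1*d3*k^2 + 2*d1*d3) 10 0 1 0 0
    + T (d4^2) 2 4 0 0 0
    + T (3*b2*c2^2 - b2^2*c2*k - 3*c2*d4*k^2 + 2*d2*d4) 5 3 0 0 0
    + T (3*a1*b2*c2*k^2 - 2*b1*b2*c2*k + 3*b1*c2^2 + 6*b2*c1*c2 - b2^2*c1*k - 3*c1*d4*k^2 - 3*c2*d2*k^2 + 2*d1*d4 + d2^2) 8 2 0 0 0
    + T (3*a1*b1*c2*k^2 + 3*a1*b2*c1*k^2 + a1*c2*k^6 - 3*a1^2*c2*k^3 + a1^3*c2 - 2*b1*b2*c1*k + 6*b1*c1*c2 - b1^2*c2*k + 3*b2*c1^2 - 3*c1*d2*k^2 - 3*c2*d1*k^2 + 2*d1*d2) 11 1 0 0 0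
    + T (3*a1*b1*c1*k^2 + a1*c1*k^6 - 3*a1^2*c1*k^3 + a1^3*c1 + 3*b1*c1^2 - b1^2*c1*k - 3*c1*d1*k^2 + d1^2) 14 0 0 0 0 := by
      rw [hg14]
      simp only [map_add, map_sub, map_mul, map_pow, map_neg, map_ofNat, hφ1, hφ3, hφ4, hφ5, hφ7]
      simp only [hy1, hy3, hy4, hy5, hy7, T_eq, map_add, map_sub, map_mul, map_pow, map_neg, map_ofNat, map_zero, map_one]
      ring
    rw [f14, hJ] at h14
    obtain ⟨m14_10_1111, m14_10_13, m14_10_4, m14_12_11, m14_14_, m14_8_111111, m14_8_1113, m14_8_114, m14_8_15, m14_8_33, e14_0_0_0_0_2, e14_0_3_0_1_0, e14_0_2_2_0_0, e14_0_1_1_0_1, e14_0_0_1_2_0, e14_1_2_0_0_1, e14_1_1_0_2_0, e14_2_0_0_1_1, e14_2_4_0_0_0, e14_2_0_3_0_0, e14_3_1_2_0_0, e14_4_1_0_0_1, e14_4_0_0_2_0, e14_7_0_0_0_1, e14_6_0_2_0_0, e14_8_2_0_0_0, e14_14_0_0_0_0⟩ := deg14_coeff k a1 b1 b2 c1 c2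 d1 d2 d3 d4 d5 d6 d7 h14
    clear f14 h14
    have i1 : m14_14_ = d7 ^ 2 := by linarith
    have i2 : m14_8_33 = d7 ^ 2 / 4 := by linarith
    have i3 : d6 ^ 2 = 3 / 2 * d7 ^ 2 := by linarith
    have i4 : d6 * d7 = 3 * d7 ^ 2 := by linarith
    obtain rfl : d7 = 0 := by
      have : d7 ^ 4 = 0 := by linear_combination (2 / 15) * d7 ^ 2 * i3 - (2 / 15) * (d6 * d7 + 3 * d7 ^ 2) * i4
      exact pow_eq_zero_iff (four_ne_zero) |>.1 this
    obtain rfl : d6 = 0 := by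
      have : d6 ^ 2 = 0 := by linear_combination i3
      exact pow_eq_zero_iff (two_ne_zero) |>.1 this
    obtain rfl : m14_8_33 = 0 := by linarith
    obtain rfl : m14_10_13 = 0 := by linarith
    obtain rfl : m14_8_15 = 0 := by linarith
    obtain rfl : m14_14_ = 0 := by linarith
    obtain rfl : m14_12_11 = 0 := by linarith
    obtain rfl : d4 = 0 := by
      have : d4 ^ 2 = 0 := by linarith
      exact pow_eq_zero_iff (two_ne_zero) |>.1 this
    obtain rfl : b2 = 0 := by
      have : b2 ^ 2 = 0 := by linear_combination (1 / 6) * e8_2_2_0_0_0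
      exact pow_eq_zero_iff (two_ne_zero) |>.1 this
    obtain rfl : m10_8_11 = 0 := by linarith
    obtain rfl : c2 = 0 := by
      have : c2 ^ 2 = 0 := by linear_combination e10_4_2_0_0_0
      exact pow_eq_zero_iff (two_ne_zero) |>.1 this
    obtain rfl : m14_8_114 = 0 := by linarith
    obtain rfl : m14_8_1113 = 0 := by linarith
    obtain rfl : m14_10_1111 = 0 := by linarith
    obtain rfl : m14_8_111111 = 0 := by linarith
    obtain rfl : d5 = 0 := by
      have : d5 ^ 2 = 0 := by linear_combination e14_4_0_0_2_0
      exact pow_eq_zero_iff (two_ne_zero) |>.1 this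
    obtain rfl : d3 = 0 := by
      have : d3 ^ 2 = 0 := by linear_combination e14_6_0_2_0_0
      exact pow_eq_zero_iff (two_ne_zero) |>.1 this
    obtain rfl : d2 = 0 := by
      have : d2 ^ 2 = 0 := by linear_combination e14_8_2_0_0_0
      exact pow_eq_zero_iff (two_ne_zero) |>.1 this
    have f18 : φ g18 = T (8*a1*b1*c1*k^6 - 18*a1*b1*d1*k^4 + 24*a1*b1^2*c1*k^2 - 2*a1*b1^2*k^7 - 6*a1*b1^3*k^3 - 8*a1*c1*d1*k^3 + 8*a1*c1^3 - 6*a1*d1*k^8 - 24*a1^2*b1*c1*k^3 + 6*a1^2*b1*k^8 + 15*a1^2*b1^2*k^4 - 4*a1^2*c1*d1 + 18*a1^2*d1*k^5 + a1^2*k^12 + 8*a1^3*b1*c1 - 18*a1^3*b1*k^5 - 2*a1^3*b1^2*k - 6*a1^3*d1*k^2 - 6*a1^3*k^9 + 6*a1^4*b1*k^2 + 11*a1^4*k^6 - 6*a1^5*k^3 + a1^6 - 12*b1*c1*d1*k^2 - 4*b1*d1^2 + 12*b1^2*c1^2 + 6*b1^2*d1*k^3 - 8*b1^3*c1*k + b1^4*k^2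 + 4*c1*d1*k^6 - 12*c1^2*d1*k + 9*d1^2*k^4) 18 0 0 0 0 := by
      rw [hg18]
      simp only [map_add, map_sub, map_mul, map_pow, map_neg, map_ofNat, hφ1, hφ3, hφ4, hφ5, hφ7]
      simp only [hy1, hy3, hy4, hy5, hy7, T_eq, map_add, map_sub, map_mul, map_pow, map_neg, map_ofNat, map_zero, map_one]
      ring
    rw [f18, hJ] at h18
    have i18 := deg18_coeff _ h18
    clear f18 h18
    obtain rfl : m12_8_1111 = 0 := by linarith
    obtain rfl : m12_12_ = 0 := by linarith
    obtain ⟨rfl, rfl, rfl, rfl, rfl⟩ := rat_points k a1 b1 c1 d1 (by linear_combination e8_8_0_0_0_0)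
      (by linear_combination e10_10_0_0_0_0) (by linear_combination e12_12_0_0_0_0)
      (by linear_combination e14_14_0_0_0_0) (by linear_combination i18)
    norm_num
  · have hb3 : b3 ≠ 0 := by
      rintro rfl
      exact hl (by linarith)
    have ha2 : a2 ≠ 0 := by
      rintro rfl
      exact hl (by linarith)
    have hc4 : c4 ≠ 0 := by
      rintro rfl
      exact hl (by linarith)
    have hk : k ≠ 0 := by
      rintro rfl
      exact hl (by linarith)
    obtain rfl : d4 = 0 := mul_left_cancel₀ ha2 (by linear_combination (-1 / 2) * e10_1_3_0_0_0)
    obtain rfl : d6 = 0 := mul_left_cancel₀ ha2 (by linear_combination (-1 / 2) * e10_0_2_1_0_0)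
    obtain rfl : c3 = 0 := mul_left_cancel₀ hc4 (by linear_combination (1 / 2) * e10_1_0_1_1_0)
    obtain rfl : m10_8_11 = 0 := by linarith
    obtain rfl : m12_8_13 = 0 := by linarith
    obtain rfl : m12_8_4 = 0 := by linarith
    have j1 : m8_8_ = b3 ^ 2 := by linarith
    have j2 : m12_12_ = b3 ^ 3 := by linarith
    have j3 : b2 = a2 * k - b3 := mul_left_cancel₀ hb3 (by linear_combination (1 / 12) * e8_1_1_1_0_0 - j1)
    have j4 : b3 = a2 * k := mul_left_cancel₀ (pow_ne_zero 2 hb3)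
      (by linear_combination (1 / 8) * e12_1_1_2_0_0 + (1 / 2) * j2 + (12 / 8) * b3 ^ 2 * j3)
    obtain rfl : b2 = 0 := by linarith
    subst j4
    have j5 : a2 = k ^ 3 := mul_left_cancel₀ (pow_ne_zero 3 ha2)
      (by linear_combination j2 - (1 / 3) * e12_0_4_0_0_0)
    subst j5
    have j6 : c4 = k ^ 5 := mul_left_cancel₀ ha2 (by linear_combination j1 - (1 / 4) * e8_0_1_0_1_0)
    have j7 : d7 = k ^ 7 := mul_left_cancel₀ hk (by linear_combination j1 + (1 / 4) * e8_1_0_0_0_1)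
    subst j6 j7 j1
    obtain rfl : c2 = 0 := mul_left_cancel₀ ha2 (by linear_combination (-1 / 4) * e8_2_2_0_0_0)
    obtain rfl : d5 = 0 := mul_left_cancel₀ ha2 (by linear_combination (-1 / 2) * e10_2_1_0_1_0)
    obtain rfl : a1 = 0 := mul_left_cancel₀ hc4 (by linear_combination (-1 / 4) * e8_3_0_0_1_0)
    obtain rfl : d3 = 0 := mul_left_cancel₀ ha2 (by linear_combination (-1 / 2) * e10_3_1_1_0_0)
    obtain rfl : b1 = 0 := mul_left_cancel₀ hb3 (by linear_combination (1 / 12) * e8_4_0_1_0_0)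
    obtain rfl : d2 = 0 := mul_left_cancel₀ ha2 (by linear_combination (-1 / 2) * e10_4_2_0_0_0)
    obtain rfl : c1 = 0 := mul_left_cancel₀ ha2 (by linear_combination (-1 / 4) * e8_5_1_0_0_0)
    obtain rfl : d1 = 0 := mul_left_cancel₀ hk (by linear_combination (1 / 4) * e8_8_0_0_0_0)
    refine ⟨rfl, rfl, rfl, rfl, rfl, rfl, rfl, rfl, rfl, rfl, rfl, rfl, rfl, ?_, rfl, rfl⟩
    ring
end
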